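/- arXiv:2508.14334 — 2 statements merged into one kernel-verified Lean document; each statement's English description precedes it below -/
import Mathlib

section
/- For every positive integer d with d ≥ 2 there exists a constant C depending only on d such that the following holds. Let n be a positive integer and let 𝓕 ⊆ binom([n], d+1) be a family with VC-dimension at most d. Then |∂̄𝓕| ≤ (10/9)·(binom(n−1, d) − |𝓕| + C·n^{d−2}), where ∂̄𝓕 = binom([n], d) \ ∂𝓕. -/
open Finset

/-- `S` is shattered by the family `𝓕`. -/
def Shatters' {n : ℕ} (𝓕 : Finset (Finset (Fin n))) (S : Finset (Fin n)) : Prop :=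
  ∀ A ⊆ S, ∃ F ∈ 𝓕, F ∩ S = A

/-- The VC-dimension of `𝓕` is at most `d`. -/
def VCDimLE {n : ℕ} (𝓕 : Finset (Finset (Fin n))) (d : ℕ) : Prop :=
  ∀ S : Finset (Fin n), Shatters' 𝓕 S → S.card ≤ d

/-- `T` is a `𝓖`-certificate of `F`: a proper subset of `F` such that no member of `𝓖`
meets `F` exactly in `T`. -/
def IsCert {n : ℕ} (𝓖 : Finset (Finset (Fin n))) (F T : Finset (Fin n)) : Prop :=
  T ⊂ F ∧ ∀ F' ∈ 𝓖, F' ∩ F ≠ T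

/-- `c` assigns to each member of `𝓖` a maximum `𝓖`-certificate. -/
def IsMaxCertAssignment {n : ℕ} (𝓖 : Finset (Finset (Fin n)))
    (c : Finset (Fin n) → Finset (Fin n)) : Prop :=
  ∀ F ∈ 𝓖, IsCert 𝓖 F (c F) ∧ ∀ T : Finset (Fin n), IsCert 𝓖 F T → T.card ≤ (c F).card

/-- The shadow `∂𝓗`: all sets obtained from a member of `𝓗` by removing one element. -/
def shadow' {n : ℕ} (𝓗 : Finset (Finset (Fin n))) : Finset (Finset (Fin n)) :=
  Finset.univ.filter (fun S => ∃ F ∈ 𝓗, S ⊆ F ∧ S.card + 1 = F.card)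

/-- `∂̄𝓗 = binom([n], d) \ ∂𝓗`. -/
def compShadow {n : ℕ} (d : ℕ) (𝓗 : Finset (Finset (Fin n))) : Finset (Finset (Fin n)) :=
  Finset.powersetCard d (Finset.univ : Finset (Fin n)) \ shadow' 𝓗

/-- A family of minimal transversals of `𝓗`, each of bounded size, is itself bounded. -/
lemma card_minimal_transversals_le {α : Type*} [DecidableEq α] (k : ℕ) (hk : 1 ≤ k)
    (𝓗 𝓔 : Finset (Finset α)) (h𝓗 : ∀ h ∈ 𝓗, h.card ≤ k)
    (hcover : ∀ e ∈ 𝓔, ∀ h ∈ 𝓗, (h ∩ e).Nonempty)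
    (hmin : ∀ e ∈ 𝓔, ∀ v ∈ e, ∃ h ∈ 𝓗, h ∩ e = {v}) (j : ℕ) (S : Finset α) :
    (𝓔.filter (fun e => S ⊆ e ∧ e.card ≤ S.card + j)).card ≤ k ^ j := by
  induction j generalizing S with
  | zero =>
    rw [pow_zero, Finset.card_le_one]
    intro a ha b hb
    simp only [Finset.mem_filter] at ha hb
    rw [← Finset.eq_of_subset_of_card_le ha.2.1 (by omega),
      ← Finset.eq_of_subset_of_card_le hb.2.1 (by omega)]
  | succ j ih =>
    by_cases hS : ∀ h ∈ 𝓗, (h ∩ S).Nonempty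
    · have hle : (𝓔.filter (fun e => S ⊆ e ∧ e.card ≤ S.card + (j + 1))) ⊆ {S} := by
        intro e he
        simp only [Finset.mem_filter] at he
        obtain ⟨he, hSe, -⟩ := he
        rw [Finset.mem_singleton]
        refine (Finset.Subset.antisymm hSe fun v hv => ?_).symm
        obtain ⟨h, hh, hhe⟩ := hmin e he v hv
        obtain ⟨w, hw⟩ := hS h hh
        rw [Finset.mem_inter] at hw
        have hwv : w ∈ ({v} : Finset α) := by
          rw [← hhe, Finset.mem_inter]
          exact ⟨hw.1, hSe hw.2⟩
        rw [Finset.mem_singleton] at hwv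
        exact hwv ▸ hw.2
      calc _ ≤ ({S} : Finset (Finset α)).card := Finset.card_le_card hle
        _ = 1 := Finset.card_singleton S
        _ ≤ k ^ (j + 1) := Nat.one_le_pow _ _ hk
    · push Not at hS
      obtain ⟨h, hh, hhS⟩ := hS
      have hle : (𝓔.filter (fun e => S ⊆ e ∧ e.card ≤ S.card + (j + 1))) ⊆
          h.biUnion (fun v => 𝓔.filter
            (fun e => insert v S ⊆ e ∧ e.card ≤ (insert v S).card + j)) := by
        intro e he
        simp only [Finset.mem_filter] at he
        obtain ⟨he, hSe, hcard⟩ := he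
        obtain ⟨v, hv⟩ := hcover e he h hh
        rw [Finset.mem_inter] at hv
        have hvS : v ∉ S := fun hvS => by
          have : v ∈ h ∩ S := Finset.mem_inter.2 ⟨hv.1, hvS⟩
          simp [hhS] at this
        simp only [Finset.mem_biUnion, Finset.mem_filter]
        refine ⟨v, hv.1, he, Finset.insert_subset hv.2 hSe, ?_⟩
        rw [Finset.card_insert_of_notMem hvS]
        omega
      calc _ ≤ _ := Finset.card_le_card hle
        _ ≤ h.card * k ^ j := Finset.card_biUnion_le_card_mul _ _ _ fun v _ => ih _
        _ ≤ k * k ^ j := Nat.mul_le_mul_right _ (h𝓗 h hh)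
        _ = k ^ (j + 1) := by ring

/-- `c` assigns to each member `F` of the `(d+1)`-uniform family `𝓕` a proper subset which is not
a trace of `𝓕` on `F`, although each of its one-point extensions is. -/
structure CertSystem {α : Type*} [DecidableEq α] (d : ℕ) (𝓕 : Finset (Finset α))
    (c : Finset α → Finset α) : Prop where
  card_eq : ∀ F ∈ 𝓕, F.card = d + 1
  ssubset : ∀ F ∈ 𝓕, c F ⊂ F
  inter_ne : ∀ F ∈ 𝓕, ∀ G ∈ 𝓕, G ∩ F ≠ c F
  exists_inter_eq : ∀ F ∈ 𝓕, ∀ v ∈ F, v ∉ c F → ∃ G ∈ 𝓕, G ∩ F = insert v (c F)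

namespace CertSystem

variable {α : Type*} [DecidableEq α] {d : ℕ} {𝓕 : Finset (Finset α)} {c : Finset α → Finset α}

lemma card_cert_le (h : CertSystem d 𝓕 c) {F : Finset α} (hF : F ∈ 𝓕) : (c F).card ≤ d := by
  have := Finset.card_lt_card (h.ssubset F hF)
  rw [h.card_eq F hF] at this
  omega

/-- A member containing the certificate of `F` meets `F` outside of that certificate. -/
lemma exists_mem_inter (h : CertSystem d 𝓕 c) {F G : Finset α} (hF : F ∈ 𝓕) (hG : G ∈ 𝓕)
    (hcG : c F ⊆ G) : ∃ y ∈ G, y ∈ F ∧ y ∉ c F := by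
  by_contra! hcon
  refine h.inter_ne F hF G hG (Finset.Subset.antisymm (fun y hy => ?_) fun y hy => ?_)
  · rw [Finset.mem_inter] at hy
    exact hcon y hy.1 hy.2
  · exact Finset.mem_inter.2 ⟨hcG hy, (h.ssubset F hF).1 hy⟩

/-- A certificate of size `d` is contained in a unique member of the family. -/
lemma eq_of_cert_subset (h : CertSystem d 𝓕 c) {F G : Finset α} (hF : F ∈ 𝓕) (hG : G ∈ 𝓕)
    (hcard : (c F).card = d) (hcG : c F ⊆ G) : G = F := by
  obtain ⟨y, hyG, hyF, hyc⟩ := h.exists_mem_inter hF hG hcG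
  have hcardi : (insert y (c F)).card = d + 1 := by rw [Finset.card_insert_of_notMem hyc, hcard]
  have h1 : insert y (c F) = F := Finset.eq_of_subset_of_card_le
    (Finset.insert_subset hyF (h.ssubset F hF).1) (by rw [hcardi, h.card_eq F hF])
  have h2 : insert y (c F) = G := Finset.eq_of_subset_of_card_le
    (Finset.insert_subset hyG hcG) (by rw [hcardi, h.card_eq G hG])
  rw [← h2, h1]

/-- Boundedly many members share a given certificate. -/
lemma card_fiber_le (h : CertSystem d 𝓕 c) (T : Finset α) :
    (𝓕.filter (fun F => c F = T)).card ≤ (d + 1) ^ (d + 1) := by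
  set 𝓖 := 𝓕.filter (fun F => c F = T) with h𝓖
  set 𝓗 := (𝓕.filter (fun G => T ⊆ G)).image (fun G => G \ T) with h𝓗
  have key := card_minimal_transversals_le (d + 1) (by omega) 𝓗 (𝓖.image (fun F => F \ T))
    (by
      intro e he
      simp only [h𝓗, Finset.mem_image, Finset.mem_filter] at he
      obtain ⟨G, ⟨hG, -⟩, rfl⟩ := he
      rw [← h.card_eq G hG]
      exact Finset.card_le_card Finset.sdiff_subset)
    (by
      intro e he g hg
      simp only [h𝓖, h𝓗, Finset.mem_image, Finset.mem_filter] at he hg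
      obtain ⟨F, ⟨hF, hcF⟩, rfl⟩ := he
      obtain ⟨G, ⟨hG, hTG⟩, rfl⟩ := hg
      obtain ⟨y, hyG, hyF, hyc⟩ := h.exists_mem_inter hF hG (hcF ▸ hTG)
      rw [hcF] at hyc
      exact ⟨y, by simp [hyG, hyF, hyc]⟩)
    (by
      intro e he v hv
      simp only [h𝓖, Finset.mem_image, Finset.mem_filter] at he
      obtain ⟨F, ⟨hF, hcF⟩, rfl⟩ := he
      rw [Finset.mem_sdiff] at hv
      obtain ⟨G, hG, hGF⟩ := h.exists_inter_eq F hF v hv.1 (hcF ▸ hv.2)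
      rw [hcF] at hGF
      refine ⟨G \ T, ?_, ?_⟩
      · simp only [h𝓗, Finset.mem_image, Finset.mem_filter]
        refine ⟨G, ⟨hG, fun y hy => ?_⟩, rfl⟩
        have : y ∈ G ∩ F := hGF ▸ Finset.mem_insert_of_mem hy
        exact (Finset.mem_inter.1 this).1
      · ext y
        have hy := Finset.ext_iff.1 hGF y
        simp only [Finset.mem_inter, Finset.mem_insert] at hy
        simp only [Finset.mem_inter, Finset.mem_sdiff, Finset.mem_singleton]
        constructor
        · rintro ⟨⟨h1, h2⟩, h3, -⟩
          exact (hy.1 ⟨h1, h3⟩).resolve_right h2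
        · rintro rfl
          exact ⟨⟨(hy.2 (Or.inl rfl)).1, hv.2⟩, hv⟩)
    (d + 1) ∅
  have hfull : (𝓖.image (fun F => F \ T)).filter
      (fun e => ∅ ⊆ e ∧ e.card ≤ (∅ : Finset α).card + (d + 1)) = 𝓖.image (fun F => F \ T) := by
    refine Finset.filter_true_of_mem fun e he => ⟨Finset.empty_subset _, ?_⟩
    simp only [h𝓖, Finset.mem_image, Finset.mem_filter] at he
    obtain ⟨F, ⟨hF, -⟩, rfl⟩ := he
    rw [Finset.card_empty, zero_add, ← h.card_eq F hF]
    exact Finset.card_le_card Finset.sdiff_subset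
  rw [hfull, Finset.card_image_of_injOn] at key
  · exact key
  · intro F hF G hG hFG
    rw [Finset.mem_coe, h𝓖, Finset.mem_filter] at hF hG
    have hTF : T ⊆ F := hF.2 ▸ (h.ssubset F hF.1).1
    have hTG : T ⊆ G := hG.2 ▸ (h.ssubset G hG.1).1
    simp only at hFG
    rw [← Finset.sdiff_union_of_subset hTF, hFG, Finset.sdiff_union_of_subset hTG]

/-- A set of certificates bounds the number of members having them. -/
lemma card_le_of_cert_mem (h : CertSystem d 𝓕 c) {𝓖 : Finset (Finset α)} (h𝓖 : 𝓖 ⊆ 𝓕)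
    (𝓣 : Finset (Finset α)) (h𝓣 : ∀ F ∈ 𝓖, c F ∈ 𝓣) :
    𝓖.card ≤ 𝓣.card * (d + 1) ^ (d + 1) := by
  have hsub : 𝓖 ⊆ 𝓣.biUnion (fun T => 𝓕.filter (fun F => c F = T)) := fun F hF => by
    simp only [Finset.mem_biUnion, Finset.mem_filter]
    exact ⟨c F, h𝓣 F hF, h𝓖 hF, rfl⟩
  exact (Finset.card_le_card hsub).trans
    (Finset.card_biUnion_le_card_mul _ _ _ fun T _ => h.card_fiber_le T)

/-- In a pair of members sharing all but one element, each containing the certificate of the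
other, the position of a further such pair is very restricted. -/
lemma conflict_apex_eq (h : CertSystem d 𝓕 c) {F G X H W : Finset α} {t s a b u v x : α}
    (hF : F ∈ 𝓕) (hG : G ∈ 𝓕) (hX : X ∈ 𝓕) (hH : H ∈ 𝓕) (hW : W.card + 2 = d)
    (hFe : F = insert a (insert s (insert t W))) (hGe : G = insert b (insert s (insert t W)))
    (hXe : X = insert x (insert v (insert u W)))
    (hcF : c F = insert t W) (hcG : c G = insert s W) (hcX : c X = insert u W)
    (huF : u ∉ F) (huG : u ∉ G) (hvF : v ∉ F) (hvG : v ∉ G) (htW : t ∉ W)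
    (hHsub : insert u (insert t W) ⊆ H) : x = a := by
  have htF : t ∈ F := by simp [hFe]
  have hWF : W ⊆ F := fun w hw => by simp [hFe, hw]
  have hWG : W ⊆ G := fun w hw => by simp [hGe, hw]
  have htH : t ∈ H := hHsub (by simp)
  have huH : u ∈ H := hHsub (by simp)
  have hWH : W ⊆ H := fun w hw => hHsub (by simp [hw])
  have huW : u ∉ W := fun hu => huF (hWF hu)
  have hut : u ≠ t := fun hu => huF (hu ▸ htF)
  obtain ⟨y, hyH, hyF, hyc⟩ := h.exists_mem_inter hF hH
    (by rw [hcF]; exact Finset.insert_subset htH hWH)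
  rw [hcF, Finset.mem_insert, not_or] at hyc
  have hyu : y ≠ u := fun hy => huF (hy ▸ hyF)
  have hHe : insert y (insert u (insert t W)) = H := by
    refine Finset.eq_of_subset_of_card_le (Finset.insert_subset hyH hHsub) ?_
    rw [h.card_eq H hH, Finset.card_insert_of_notMem (by simp [hyc, hyu]),
      Finset.card_insert_of_notMem (by simp [hut, huW]), Finset.card_insert_of_notMem htW]
    omega
  obtain ⟨z, hzH, hzX, hzc⟩ := h.exists_mem_inter hX hH
    (by rw [hcX]; exact Finset.insert_subset huH hWH)
  rw [hcX, Finset.mem_insert, not_or] at hzc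
  have hzF : z ∈ F := by
    rw [← hHe] at hzH
    simp only [Finset.mem_insert] at hzH
    rcases hzH with rfl | rfl | rfl | hz
    · exact hyF
    · exact absurd rfl hzc.1
    · exact htF
    · exact hWF hz
  have hxF : x ∈ F := by
    rw [hXe] at hzX
    simp only [Finset.mem_insert] at hzX
    rcases hzX with rfl | rfl | hz | hz
    · exact hzF
    · exact absurd hzF hvF
    · exact absurd hz hzc.1
    · exact absurd hz hzc.2
  have hxF' := hxF
  rw [hFe] at hxF'
  simp only [Finset.mem_insert] at hxF'
  rcases hxF' with hx | hx | hx | hx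
  · exact hx
  · exfalso
    refine h.inter_ne G hG X hX ?_
    rw [hcG, hXe, hx, Finset.insert_inter_of_mem (by simp [hGe]),
      Finset.insert_inter_of_notMem hvG, Finset.insert_inter_of_notMem huG,
      Finset.inter_eq_left.2 hWG]
  · exfalso
    refine h.inter_ne F hF X hX ?_
    rw [hcF, hXe, hx, Finset.insert_inter_of_mem htF,
      Finset.insert_inter_of_notMem hvF, Finset.insert_inter_of_notMem huF,
      Finset.inter_eq_left.2 hWF]
  · exfalso
    have h1 := h.card_eq X hX
    rw [hXe, Finset.insert_eq_of_mem (by simp [hx])] at h1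
    have h2 := Finset.card_insert_le v (insert u W)
    have h3 := Finset.card_insert_le u W
    omega

end CertSystem

/-- The `d`-sets contained in no member of `𝓕`. -/
def uncovered {α : Type*} [Fintype α] [DecidableEq α] (d : ℕ) (𝓕 : Finset (Finset α)) :
    Finset (Finset α) :=
  (Finset.powersetCard d Finset.univ).filter (fun S => ∀ F ∈ 𝓕, ¬ S ⊆ F)

/-- The members of `𝓕` with a certificate of size `d - 1` in fewer than `L` uncovered sets. -/
def richMembers {α : Type*} [Fintype α] [DecidableEq α] (d L : ℕ) (𝓕 : Finset (Finset α))
    (c : Finset α → Finset α) : Finset (Finset α) :=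
  𝓕.filter (fun F => (c F).card + 1 = d ∧
    ((uncovered d 𝓕).filter (fun S => c F ⊆ S)).card < L)

/-- Two members, each containing the certificate of the other one, whose certificates are
different but differ in one element only. -/
def CertConflict {α : Type*} [DecidableEq α] (d : ℕ) (c : Finset α → Finset α)
    (F G : Finset α) : Prop :=
  c F ≠ c G ∧ c G ⊆ F ∧ c F ⊆ G ∧ (c F ∪ c G).card ≤ d

instance {α : Type*} [DecidableEq α] (d : ℕ) (c : Finset α → Finset α) (F G : Finset α) :
    Decidable (CertConflict d c F G) :=
  inferInstanceAs (Decidable (_ ∧ _))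

/-- The shape of a conflicting pair. -/
lemma CertConflict.exists_eq {α : Type*} [DecidableEq α] {d : ℕ} {𝓕 : Finset (Finset α)}
    {c : Finset α → Finset α} (h : CertSystem d 𝓕 c) {F G : Finset α}
    (hF : F ∈ 𝓕) (hG : G ∈ 𝓕) (hcF : (c F).card + 1 = d) (hcG : (c G).card + 1 = d)
    (hFG : CertConflict d c F G) :
    ∃ t s a b, (c F ∩ c G).card + 2 = d ∧ c F = insert t (c F ∩ c G) ∧
      c G = insert s (c F ∩ c G) ∧ t ∉ c F ∩ c G ∧ s ∉ c F ∩ c G ∧ t ≠ s ∧ a ≠ b ∧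
      F = insert a (insert s (insert t (c F ∩ c G))) ∧
      G = insert b (insert s (insert t (c F ∩ c G))) := by
  obtain ⟨hne, hGF, hFG, hcard⟩ := hFG
  have hlt : (c F ∩ c G).card < (c F).card := by
    refine Finset.card_lt_card (Finset.inter_subset_left.ssubset_of_ne fun heq => hne ?_)
    exact Finset.eq_of_subset_of_card_le (Finset.inter_eq_left.1 heq) (by omega)
  have hui := Finset.card_union_add_card_inter (c F) (c G)
  have hW : (c F ∩ c G).card + 2 = d := by omega
  have hext : ∀ A B : Finset α, A ⊆ B → B.card = A.card + 1 → ∃ x, x ∉ A ∧ B = insert x A := by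
    intro A B hAB hB
    obtain ⟨x, hx⟩ := Finset.exists_mem_notMem_of_card_lt_card (by omega : A.card < B.card)
    refine ⟨x, hx.2, (Finset.eq_of_subset_of_card_le
      (Finset.insert_subset hx.1 hAB) ?_).symm⟩
    rw [Finset.card_insert_of_notMem hx.2, hB]
  obtain ⟨t, htW, ht⟩ := hext _ _ (Finset.inter_subset_left (s₁ := c F) (s₂ := c G)) (by omega)
  obtain ⟨s, hsW, hs⟩ := hext _ _ (Finset.inter_subset_right (s₁ := c F) (s₂ := c G)) (by omega)
  generalize hWe : c F ∩ c G = W at *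
  have hts : t ≠ s := fun hts => hne (by rw [ht, hs, hts])
  have hcardU : (insert s (insert t W)).card = d := by
    rw [Finset.card_insert_of_notMem (by simp [hts.symm, hsW]), Finset.card_insert_of_notMem htW]
    omega
  have hUF : insert s (insert t W) ⊆ F := by
    refine Finset.insert_subset (hGF (by simp [hs])) ?_
    rw [← ht]
    exact (h.ssubset F hF).1
  have hUG : insert s (insert t W) ⊆ G := by
    rw [Finset.insert_comm]
    refine Finset.insert_subset (hFG (by simp [ht])) ?_
    rw [← hs]
    exact (h.ssubset G hG).1
  obtain ⟨a, haU, ha⟩ := hext _ _ hUF (by rw [h.card_eq F hF, hcardU])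
  obtain ⟨b, hbU, hb⟩ := hext _ _ hUG (by rw [h.card_eq G hG, hcardU])
  refine ⟨t, s, a, b, hW, ht, hs, htW, hsW, hts, fun hab => hne ?_, ha, hb⟩
  rw [show F = G by rw [ha, hb, hab]]

namespace CertSystem

variable {α : Type*} [Fintype α] [DecidableEq α] {d L : ℕ} {𝓕 : Finset (Finset α)}
  {c : Finset α → Finset α}

lemma mem_uncovered {S : Finset α} :
    S ∈ uncovered d 𝓕 ↔ S.card = d ∧ ∀ F ∈ 𝓕, ¬ S ⊆ F := by
  simp [uncovered]

lemma mem_richMembers {F : Finset α} : F ∈ richMembers d L 𝓕 c ↔ F ∈ 𝓕 ∧ (c F).card + 1 = d ∧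
    ((uncovered d 𝓕).filter (fun S => c F ⊆ S)).card < L := by
  simp [richMembers]

lemma card_insert_uncovered_lt {F : Finset α} (hF : F ∈ richMembers d L 𝓕 c) :
    (univ.filter (fun y => insert y (c F) ∈ uncovered d 𝓕)).card < L := by
  obtain ⟨hF, hc, hL⟩ := mem_richMembers.1 hF
  refine lt_of_le_of_lt (Finset.card_le_card_of_injOn (fun y => insert y (c F)) ?_ ?_) hL
  · intro y hy
    rw [Finset.mem_coe, Finset.mem_filter] at hy
    rw [Finset.mem_coe, Finset.mem_filter]
    exact ⟨hy.2, Finset.subset_insert _ _⟩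
  · intro y hy z hz hyz
    have hnot : ∀ x ∈ univ.filter (fun y => insert y (c F) ∈ uncovered d 𝓕), x ∉ c F := by
      intro x hx hxc
      have h1 := (mem_uncovered.1 (Finset.mem_filter.1 hx).2).1
      rw [Finset.insert_eq_of_mem hxc] at h1
      omega
    have hz' : z ∈ insert y (c F) := by
      have : insert y (c F) = insert z (c F) := hyz
      rw [this]
      exact Finset.mem_insert_self _ _
    rcases Finset.mem_insert.1 hz' with hzy | hzc
    · exact hzy.symm
    · exact absurd hzc (hnot z hz)

/-- Boundedly many rich members are in conflict along a given `(d-2)`-set. -/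
lemma card_conflict_fiber_le (h : CertSystem d 𝓕 c) (W : Finset α) :
    ((richMembers d L 𝓕 c).filter (fun F => ∃ G ∈ richMembers d L 𝓕 c,
      CertConflict d c F G ∧ c F ∩ c G = W)).card ≤
      (2 * (d + 1) + L) * (d + 1) ^ (d + 1) * (1 + (d + 1) * (d + 1) ^ (d + 1)) := by
  set 𝓟 := (richMembers d L 𝓕 c).filter (fun F => ∃ G ∈ richMembers d L 𝓕 c,
      CertConflict d c F G ∧ c F ∩ c G = W) with h𝓟
  rcases 𝓟.eq_empty_or_nonempty with h0 | ⟨F, hFP⟩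
  · rw [h0]
    simp
  rw [h𝓟, Finset.mem_filter] at hFP
  obtain ⟨hFR, G, hGR, hFG, hWe⟩ := hFP
  obtain ⟨hF, hcF, -⟩ := mem_richMembers.1 hFR
  obtain ⟨hG, hcG, -⟩ := mem_richMembers.1 hGR
  obtain ⟨t, s, a, b, hW, ht, hs, htW, hsW, hts, hab, hFe, hGe⟩ :=
    CertConflict.exists_eq h hF hG hcF hcG hFG
  rw [hWe] at hW ht hs htW hsW hFe hGe
  set B := F ∪ G ∪ univ.filter (fun y => insert y (c F) ∈ uncovered d 𝓕) with hB
  have hBcard : B.card ≤ 2 * (d + 1) + L := by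
    have h1 : B.card ≤ _ := Finset.card_union_le _ _
    have h2 := Finset.card_union_le F G
    have h3 := card_insert_uncovered_lt hFR
    rw [h.card_eq F hF, h.card_eq G hG] at h2
    omega
  have hBmem : ∀ y, y ∉ B → y ∉ F ∧ y ∉ G ∧ ∃ H ∈ 𝓕, insert y (insert t W) ⊆ H := by
    intro y hy
    simp only [hB, Finset.mem_union, Finset.mem_filter, Finset.mem_univ, true_and, not_or] at hy
    obtain ⟨⟨hyF, hyG⟩, hyM⟩ := hy
    refine ⟨hyF, hyG, ?_⟩
    by_contra! hcon
    refine hyM (mem_uncovered.2 ⟨?_, by rwa [ht]⟩)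
    rw [Finset.card_insert_of_notMem fun hyc => hyF ((h.ssubset F hF).1 hyc)]
    exact hcF
  set 𝓠 := 𝓕.filter (fun X => c X ∈ B.image (fun y => insert y W)) with h𝓠
  have h𝓠card : 𝓠.card ≤ (2 * (d + 1) + L) * (d + 1) ^ (d + 1) :=
    (h.card_le_of_cert_mem (Finset.filter_subset _ _) (B.image (fun y => insert y W))
      fun X hX => (Finset.mem_filter.1 hX).2).trans
      (Nat.mul_le_mul_right _ (Finset.card_image_le.trans hBcard))
  set 𝓣 := 𝓠.biUnion (fun X => X.image (fun y => insert y W)) with h𝓣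
  have h𝓣card : 𝓣.card ≤ 𝓠.card * (d + 1) := by
    refine Finset.card_biUnion_le_card_mul _ _ _ fun X hX => Finset.card_image_le.trans ?_
    rw [h.card_eq X (Finset.mem_filter.1 hX).1]
  have hsub : 𝓟 ⊆ 𝓠 ∪ 𝓕.filter (fun X => c X ∈ 𝓣) := by
    intro X hX
    rw [h𝓟, Finset.mem_filter] at hX
    obtain ⟨hXR, Y, hYR, hXY, hWe'⟩ := hX
    obtain ⟨hX, hcX, -⟩ := mem_richMembers.1 hXR
    obtain ⟨hY, hcY, -⟩ := mem_richMembers.1 hYR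
    obtain ⟨u, v, x, z, -, hu, hv, huW, hvW, huv, hxz, hXe, hYe⟩ :=
      CertConflict.exists_eq h hX hY hcX hcY hXY
    rw [hWe'] at hu hv huW hvW hXe hYe
    rw [Finset.mem_union]
    by_cases huB : u ∈ B
    · left
      rw [h𝓠, Finset.mem_filter, hu]
      exact ⟨hX, Finset.mem_image_of_mem _ huB⟩
    by_cases hvB : v ∈ B
    · right
      rw [Finset.mem_filter]
      refine ⟨hX, Finset.mem_biUnion.2 ⟨Y, ?_, ?_⟩⟩
      · rw [h𝓠, Finset.mem_filter, hv]
        exact ⟨hY, Finset.mem_image_of_mem _ hvB⟩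
      · rw [hu]
        exact Finset.mem_image_of_mem _ (by simp [hYe])
    exfalso
    obtain ⟨huF, huG, H, hH, hHu⟩ := hBmem u huB
    obtain ⟨hvF, hvG, H', hH', hHv⟩ := hBmem v hvB
    have hxa : x = a := h.conflict_apex_eq hF hG hX hH hW hFe hGe hXe ht hs hu huF huG hvF hvG
      htW hHu
    have hza : z = a := h.conflict_apex_eq hF hG hY hH' hW hFe hGe
      (by rw [hYe, Finset.insert_comm v u]) ht hs hv hvF hvG huF huG htW hHv
    exact hxz (hxa.trans hza.symm)
  have h𝓣fib := h.card_le_of_cert_mem (Finset.filter_subset (fun X => c X ∈ 𝓣) 𝓕) 𝓣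
    fun X hX => (Finset.mem_filter.1 hX).2
  calc 𝓟.card ≤ _ := (Finset.card_le_card hsub).trans (Finset.card_union_le _ _)
    _ ≤ 𝓠.card + 𝓠.card * (d + 1) * (d + 1) ^ (d + 1) :=
      Nat.add_le_add_left (h𝓣fib.trans (Nat.mul_le_mul_right _ h𝓣card)) _
    _ = 𝓠.card * (1 + (d + 1) * (d + 1) ^ (d + 1)) := by ring
    _ ≤ _ := Nat.mul_le_mul_right _ h𝓠card

/-- Few rich members are in a conflict. -/
lemma card_conflict_le (h : CertSystem d 𝓕 c) :
    ((richMembers d L 𝓕 c).filter (fun F => ∃ G ∈ richMembers d L 𝓕 c,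
      CertConflict d c F G)).card ≤ (Fintype.card α).choose (d - 2) *
      ((2 * (d + 1) + L) * (d + 1) ^ (d + 1) * (1 + (d + 1) * (d + 1) ^ (d + 1))) := by
  have hsub : (richMembers d L 𝓕 c).filter (fun F => ∃ G ∈ richMembers d L 𝓕 c,
      CertConflict d c F G) ⊆ (Finset.powersetCard (d - 2) univ).biUnion (fun W =>
      (richMembers d L 𝓕 c).filter (fun F => ∃ G ∈ richMembers d L 𝓕 c,
      CertConflict d c F G ∧ c F ∩ c G = W)) := by
    intro F hF
    obtain ⟨hFR, G, hGR, hFG⟩ := Finset.mem_filter.1 hF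
    obtain ⟨hF, hcF, -⟩ := mem_richMembers.1 hFR
    obtain ⟨hG, hcG, -⟩ := mem_richMembers.1 hGR
    obtain ⟨-, -, -, -, hW, -⟩ := CertConflict.exists_eq h hF hG hcF hcG hFG
    refine Finset.mem_biUnion.2 ⟨c F ∩ c G, ?_, Finset.mem_filter.2 ⟨hFR, G, hGR, hFG, rfl⟩⟩
    rw [Finset.mem_powersetCard]
    exact ⟨Finset.subset_univ _, by omega⟩
  refine (Finset.card_le_card hsub).trans ((Finset.card_biUnion_le_card_mul _ _ _
    fun W _ => h.card_conflict_fiber_le W).trans ?_)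
  rw [Finset.card_powersetCard, Finset.card_univ]

/-- The covered `d`-sets which are not the certificate of any member. -/
def plainSets (d : ℕ) (𝓕 : Finset (Finset α)) (c : Finset α → Finset α) : Finset (Finset α) :=
  (Finset.powersetCard d univ).filter (fun O => (∃ F ∈ 𝓕, O ⊆ F) ∧ ∀ F ∈ 𝓕, c F ≠ O)

lemma mem_plainSets {O : Finset α} :
    O ∈ plainSets d 𝓕 c ↔ O.card = d ∧ (∃ F ∈ 𝓕, O ⊆ F) ∧ ∀ F ∈ 𝓕, c F ≠ O := by
  simp [plainSets]

/-- A `d`-subset of a member is plain as soon as it is not the certificate of that member. -/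
lemma mem_plainSets_of_subset (h : CertSystem d 𝓕 c) {F O : Finset α} (hF : F ∈ 𝓕)
    (hO : O.card = d) (hOF : O ⊆ F) (hne : c F ≠ O) : O ∈ plainSets d 𝓕 c := by
  refine mem_plainSets.2 ⟨hO, ⟨F, hF, hOF⟩, fun G hG hGO => hne ?_⟩
  rw [h.eq_of_cert_subset hG hF (by rw [hGO, hO]) (hGO ▸ hOF), hGO]

lemma card_plainSets_add (h : CertSystem d 𝓕 c) :
    (plainSets d 𝓕 c).card + (uncovered d 𝓕).card + (𝓕.filter (fun F => (c F).card = d)).card =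
      (Fintype.card α).choose d := by
  have himg : (𝓕.filter (fun F => (c F).card = d)).card =
      ((𝓕.filter (fun F => (c F).card = d)).image c).card := by
    refine (Finset.card_image_of_injOn fun F hF G hG hFG => ?_).symm
    rw [Finset.mem_coe, Finset.mem_filter] at hF hG
    have hFG : c F = c G := hFG
    exact h.eq_of_cert_subset hG.1 hF.1 hG.2 (hFG ▸ (h.ssubset F hF.1).1)
  have hdis1 : Disjoint (plainSets d 𝓕 c) (uncovered d 𝓕) := by
    refine Finset.disjoint_left.2 fun O hO hO' => ?_
    obtain ⟨F, hF, hOF⟩ := (mem_plainSets.1 hO).2.1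
    exact (mem_uncovered.1 hO').2 F hF hOF
  have hdis2 : Disjoint (plainSets d 𝓕 c ∪ uncovered d 𝓕)
      ((𝓕.filter (fun F => (c F).card = d)).image c) := by
    refine Finset.disjoint_right.2 fun O hO hO' => ?_
    obtain ⟨F, hF, rfl⟩ := Finset.mem_image.1 hO
    rw [Finset.mem_filter] at hF
    rcases Finset.mem_union.1 hO' with hO' | hO'
    · exact (mem_plainSets.1 hO').2.2 F hF.1 rfl
    · exact (mem_uncovered.1 hO').2 F hF.1 (h.ssubset F hF.1).1
  rw [himg, ← Finset.card_union_of_disjoint hdis1, ← Finset.card_union_of_disjoint hdis2,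
    ← Finset.card_univ, ← Finset.card_powersetCard]
  congr 1
  ext O
  simp only [Finset.mem_union, mem_plainSets, mem_uncovered, Finset.mem_image, Finset.mem_filter,
    Finset.mem_powersetCard, Finset.subset_univ, true_and]
  constructor
  · rintro ((hO | hO) | ⟨F, hF, rfl⟩)
    · exact hO.1
    · exact hO.1
    · exact hF.2
  · intro hO
    by_cases h1 : ∃ F ∈ 𝓕, O ⊆ F
    · by_cases h2 : ∃ F ∈ 𝓕, c F = O
      · obtain ⟨F, hF, rfl⟩ := h2
        exact Or.inr ⟨F, ⟨hF, hO⟩, rfl⟩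
      · push Not at h2
        exact Or.inl (Or.inl ⟨hO, h1, h2⟩)
    · push Not at h1
      exact Or.inl (Or.inr ⟨hO, h1⟩)

/-- The pairs of a plain set and an element outside of it. -/
def flags (d : ℕ) (𝓕 : Finset (Finset α)) (c : Finset α → Finset α) :
    Finset ((_ : Finset α) × α) :=
  (plainSets d 𝓕 c).sigma (fun O => univ \ O)

lemma card_flags : (flags d 𝓕 c).card = (plainSets d 𝓕 c).card * (Fintype.card α - d) := by
  rw [flags, Finset.card_sigma]
  refine Finset.sum_const_nat fun O hO => ?_
  rw [Finset.card_sdiff_of_subset (Finset.subset_univ _), Finset.card_univ, (mem_plainSets.1 hO).1]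

lemma mem_flags {f : (_ : Finset α) × α} :
    f ∈ flags d 𝓕 c ↔ f.1 ∈ plainSets d 𝓕 c ∧ f.2 ∉ f.1 := by
  simp [flags]

/-- The flags whose union is a member of the family. -/
lemma le_card_inner_flags (h : CertSystem d 𝓕 c) {𝓢 : Finset (Finset α)}
    (h𝓢 : 𝓢 ⊆ richMembers d L 𝓕 c) :
    d * (𝓕.filter (fun F => (c F).card = d)).card + (d + 1) * 𝓢.card ≤
      ((flags d 𝓕 c).filter (fun f => insert f.2 f.1 ∈ 𝓕)).card := by
  set 𝓐 := 𝓕.filter (fun F => (c F).card = d) with h𝓐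
  have hdis : Disjoint (𝓐.sigma c) (𝓢.sigma (fun F => F)) := by
    refine Finset.disjoint_left.2 fun f hf hf' => ?_
    have h1 := (Finset.mem_filter.1 (Finset.mem_sigma.1 hf).1).2
    have h2 := (mem_richMembers.1 (h𝓢 (Finset.mem_sigma.1 hf').1)).2.1
    omega
  have hcard : (𝓐.sigma c ∪ 𝓢.sigma (fun F => F)).card = d * 𝓐.card + (d + 1) * 𝓢.card := by
    rw [Finset.card_union_of_disjoint hdis, Finset.card_sigma, Finset.card_sigma,
      Finset.sum_const_nat (m := d) fun F hF => (Finset.mem_filter.1 hF).2,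
      Finset.sum_const_nat (m := d + 1) fun F hF =>
        h.card_eq F (mem_richMembers.1 (h𝓢 hF)).1]
    ring
  have hmem : ∀ f ∈ 𝓐.sigma c ∪ 𝓢.sigma (fun F => F),
      f.1 ∈ 𝓕 ∧ f.2 ∈ f.1 ∧ c f.1 ≠ f.1.erase f.2 := by
    intro f hf
    rcases Finset.mem_union.1 hf with hf | hf
    · obtain ⟨hF, hu⟩ := Finset.mem_sigma.1 hf
      have hF' := (Finset.mem_filter.1 hF).1
      refine ⟨hF', (h.ssubset _ hF').1 hu, fun heq => ?_⟩
      rw [heq] at hu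
      exact Finset.notMem_erase _ _ hu
    · obtain ⟨hF, hu⟩ := Finset.mem_sigma.1 hf
      obtain ⟨hF', hc, -⟩ := mem_richMembers.1 (h𝓢 hF)
      refine ⟨hF', hu, fun heq => ?_⟩
      rw [heq, Finset.card_erase_of_mem hu, h.card_eq _ hF'] at hc
      omega
  rw [← hcard]
  refine Finset.card_le_card_of_injOn (fun f => ⟨f.1.erase f.2, f.2⟩) ?_ ?_
  · intro f hf
    obtain ⟨hF, hu, hne⟩ := hmem f hf
    rw [Finset.mem_coe, Finset.mem_filter, mem_flags]
    refine ⟨⟨h.mem_plainSets_of_subset hF ?_ (Finset.erase_subset _ _) hne,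
      Finset.notMem_erase _ _⟩, ?_⟩
    · rw [Finset.card_erase_of_mem hu, h.card_eq _ hF, Nat.add_sub_cancel]
    · rwa [Finset.insert_erase hu]
  · rintro ⟨F, u⟩ hf ⟨G, v⟩ hg hfg
    have hu := (hmem _ hf).2.1
    have hv := (hmem _ hg).2.1
    simp only [Sigma.mk.injEq, heq_eq_eq] at hfg hu hv ⊢
    obtain ⟨h1, rfl⟩ := hfg
    exact ⟨by rw [← Finset.insert_erase hu, h1, Finset.insert_erase hv], rfl⟩

/-- The flags formed by a one-point extension of the certificate of `F` and an element outside of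
`F`, such that another extension forms a member of the family with this element. -/
def outerFlags (d : ℕ) (𝓕 : Finset (Finset α)) (c : Finset α → Finset α) (F : Finset α) :
    Finset ((_ : Finset α) × α) :=
  (flags d 𝓕 c).filter (fun f => insert f.2 f.1 ∉ 𝓕 ∧ f.2 ∉ F ∧
    (∃ p ∈ F \ c F, f.1 = insert p (c F)) ∧ ∃ q ∈ F \ c F, insert f.2 (insert q (c F)) ∈ 𝓕)

/-- The elements outside of `F` forming members of the family with all one-point extensions of the
certificate of `F`. -/
def fullPoints (𝓕 : Finset (Finset α)) (c : Finset α → Finset α) (F : Finset α) : Finset α :=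
  univ.filter (fun y => y ∉ F ∧ ∀ p ∈ F \ c F, insert y (insert p (c F)) ∈ 𝓕)

lemma disjoint_outerFlags (h : CertSystem d 𝓕 c) {F G : Finset α} (hF : F ∈ 𝓕) (hG : G ∈ 𝓕)
    (hFG : ¬ CertConflict d c F G) (hne : F ≠ G) :
    Disjoint (outerFlags d 𝓕 c F) (outerFlags d 𝓕 c G) := by
  refine Finset.disjoint_left.2 ?_
  rintro ⟨O, y⟩ hfF hfG
  simp only [outerFlags, Finset.mem_filter, Finset.mem_sdiff, mem_flags, mem_plainSets]
    at hfF hfG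
  obtain ⟨⟨⟨hO, -⟩, -⟩, hOy, hyF, ⟨p, ⟨hpF, hpc⟩, hOp⟩, q, ⟨hqF, hqc⟩, hq⟩ := hfF
  obtain ⟨-, -, hyG, ⟨r, ⟨hrG, hrc⟩, hOr⟩, -⟩ := hfG
  have hOF : O ⊆ F := hOp ▸ Finset.insert_subset hpF (h.ssubset F hF).1
  have hOG : O ⊆ G := hOr ▸ Finset.insert_subset hrG (h.ssubset G hG).1
  have hcFO : c F ⊆ O := hOp ▸ Finset.subset_insert _ _
  have hcGO : c G ⊆ O := hOr ▸ Finset.subset_insert _ _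
  have hc : c F = c G := by
    by_contra hcc
    refine hFG ⟨hcc, hcGO.trans hOF, hcFO.trans hOG, ?_⟩
    rw [← hO]
    exact Finset.card_le_card (Finset.union_subset hcFO hcGO)
  have hqp : q ∉ O := by
    intro hqO
    rw [hOp, Finset.mem_insert, or_iff_left hqc] at hqO
    rw [hqO, ← hOp] at hq
    exact hOy hq
  have hFe : insert q O = F := by
    refine Finset.eq_of_subset_of_card_le (Finset.insert_subset hqF hOF) ?_
    rw [Finset.card_insert_of_notMem hqp, h.card_eq F hF, hO]
  obtain ⟨z, hzH, hzG, hzc⟩ := h.exists_mem_inter hG hq fun x hx => by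
    rw [← hc] at hx
    simp [hx]
  have hqG : q ∈ G := by
    simp only [Finset.mem_insert] at hzH
    rcases hzH with rfl | rfl | hz
    · exact absurd hzG hyG
    · exact hzG
    · exact absurd (hc ▸ hz) hzc
  refine hne (Finset.eq_of_subset_of_card_le ?_ ?_)
  · rw [← hFe]
    exact Finset.insert_subset hqG hOG
  · rw [h.card_eq F hF, h.card_eq G hG]

lemma card_le_card_outerFlags_add (h : CertSystem d 𝓕 c) {F : Finset α}
    (hFR : F ∈ richMembers d L 𝓕 c) :
    Fintype.card α ≤ (outerFlags d 𝓕 c F).card + (fullPoints 𝓕 c F).card + (L + (d + 1)) := by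
  obtain ⟨hF, hc, -⟩ := mem_richMembers.1 hFR
  have hsub : (univ : Finset α) ⊆ (outerFlags d 𝓕 c F).image Sigma.snd ∪ fullPoints 𝓕 c F ∪
      (univ.filter (fun y => insert y (c F) ∈ uncovered d 𝓕) ∪ F) := by
    intro y _
    simp only [Finset.mem_union]
    by_cases hyF : y ∈ F
    · exact Or.inr (Or.inr hyF)
    have hyc : y ∉ c F := fun hy => hyF ((h.ssubset F hF).1 hy)
    by_cases hyM : insert y (c F) ∈ uncovered d 𝓕
    · exact Or.inr (Or.inl (by simpa using hyM))
    refine Or.inl ?_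
    by_cases hyfull : y ∈ fullPoints 𝓕 c F
    · exact Or.inr hyfull
    refine Or.inl ?_
    have hcy : (insert y (c F)).card = d := by rw [Finset.card_insert_of_notMem hyc, hc]
    rw [mem_uncovered] at hyM
    push Not at hyM
    obtain ⟨H, hH, hHsub⟩ := hyM hcy
    obtain ⟨q, hqH, hqF, hqc⟩ := h.exists_mem_inter hF hH ((Finset.subset_insert _ _).trans hHsub)
    have hqy : q ≠ y := fun hqy => hyF (hqy ▸ hqF)
    have hHe : insert y (insert q (c F)) = H := by
      rw [Finset.insert_comm]
      refine Finset.eq_of_subset_of_card_le (Finset.insert_subset hqH hHsub) ?_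
      rw [Finset.card_insert_of_notMem (by simp [hqy, hqc]), hcy, h.card_eq H hH]
    simp only [fullPoints, Finset.mem_filter, Finset.mem_univ, true_and] at hyfull
    push Not at hyfull
    obtain ⟨p, hp, hpy⟩ := hyfull hyF
    have hp' := Finset.mem_sdiff.1 hp
    have hpcard : (insert p (c F)).card = d := by rw [Finset.card_insert_of_notMem hp'.2, hc]
    refine Finset.mem_image.2 ⟨⟨insert p (c F), y⟩, ?_, rfl⟩
    refine Finset.mem_filter.2 ⟨mem_flags.2 ⟨h.mem_plainSets_of_subset hF hpcard
      (Finset.insert_subset hp'.1 (h.ssubset F hF).1) fun heq => ?_, ?_⟩, hpy, hyF,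
      ⟨p, hp, rfl⟩, q, Finset.mem_sdiff.2 ⟨hqF, hqc⟩, hHe ▸ hH⟩
    · have hcp : c F = insert p (c F) := heq
      rw [← hcp] at hpcard
      omega
    · intro hy
      rcases Finset.mem_insert.1 (show y ∈ insert p (c F) from hy) with hy | hy
      · exact hyF (hy ▸ hp'.1)
      · exact hyc hy
  have h0 := Finset.card_le_card hsub
  have h1 := Finset.card_union_le ((outerFlags d 𝓕 c F).image Sigma.snd ∪ fullPoints 𝓕 c F)
    (univ.filter (fun y => insert y (c F) ∈ uncovered d 𝓕) ∪ F)
  have h2 := Finset.card_union_le ((outerFlags d 𝓕 c F).image Sigma.snd) (fullPoints 𝓕 c F)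
  have h3 := Finset.card_union_le (univ.filter (fun y => insert y (c F) ∈ uncovered d 𝓕)) F
  have h4 := card_insert_uncovered_lt hFR
  have h5 : ((outerFlags d 𝓕 c F).image Sigma.snd).card ≤ _ := Finset.card_image_le
  rw [Finset.card_univ] at h0
  rw [h.card_eq F hF] at h3
  omega

lemma sum_card_fullPoints_le (h : CertSystem d 𝓕 c) {𝓢 : Finset (Finset α)}
    (h𝓢 : 𝓢 ⊆ richMembers d L 𝓕 c) :
    ∑ F ∈ 𝓢, (fullPoints 𝓕 c F).card ≤ d * (d + 1) ^ (d + 1) * (plainSets d 𝓕 c).card := by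
  rw [← Finset.card_sigma]
  refine Finset.card_le_mul_card_image_of_maps_to (f := fun f => insert f.2 (c f.1)) ?_ _ ?_
  · rintro ⟨F, y⟩ hf
    simp only [Finset.mem_sigma, fullPoints, Finset.mem_filter, Finset.mem_univ, true_and] at hf
    obtain ⟨hFS, hyF, hfull⟩ := hf
    obtain ⟨hF, hc, -⟩ := mem_richMembers.1 (h𝓢 hFS)
    have hcF := (h.ssubset F hF).1
    have hyc : y ∉ c F := fun hy => hyF (hcF hy)
    have hcard : 1 < (F \ c F).card := by
      rw [Finset.card_sdiff_of_subset hcF, h.card_eq F hF]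
      omega
    obtain ⟨p, hp, q, hq, hpq⟩ := Finset.one_lt_card.1 hcard
    have hsub : ∀ r, insert y (c F) ⊆ insert y (insert r (c F)) := fun r =>
      Finset.insert_subset_insert _ (Finset.subset_insert _ _)
    have hycard : (insert y (c F)).card = d := by rw [Finset.card_insert_of_notMem hyc, hc]
    refine mem_plainSets.2 ⟨hycard, ⟨_, hfull p hp, hsub p⟩, fun G hG hGe => hpq ?_⟩
    have h1 := h.eq_of_cert_subset hG (hfull p hp) (by rw [hGe, hycard]) (hGe ▸ hsub p)
    have h2 := h.eq_of_cert_subset hG (hfull q hq) (by rw [hGe, hycard]) (hGe ▸ hsub q)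
    have h3 : p ∈ insert y (insert q (c F)) := by
      rw [h2, ← h1]
      simp
    rw [Finset.mem_sdiff] at hp
    simp only [Finset.mem_insert] at h3
    rcases h3 with h3 | h3 | h3
    · exact absurd (h3 ▸ hp.1) hyF
    · exact h3
    · exact absurd h3 hp.2
  · intro O hO
    have hOcard := (mem_plainSets.1 hO).1
    have hsub : ((𝓢.sigma (fun F => fullPoints 𝓕 c F)).filter
        (fun f => insert f.2 (c f.1) = O)) ⊆ O.biUnion (fun y =>
        (𝓕.filter (fun F => c F = O.erase y)).image (fun F => (⟨F, y⟩ : (_ : Finset α) × α))) := by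
      rintro ⟨F, y⟩ hf
      simp only [Finset.mem_sigma, fullPoints, Finset.mem_filter, Finset.mem_univ, true_and] at hf
      obtain ⟨⟨hFS, hyF, -⟩, rfl⟩ := hf
      have hF := (mem_richMembers.1 (h𝓢 hFS)).1
      refine Finset.mem_biUnion.2 ⟨y, Finset.mem_insert_self _ _,
        Finset.mem_image.2 ⟨F, Finset.mem_filter.2 ⟨hF, ?_⟩, rfl⟩⟩
      rw [Finset.erase_insert fun hy => hyF ((h.ssubset F hF).1 hy)]
    refine (Finset.card_le_card hsub).trans ?_
    rw [← hOcard]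
    refine Finset.card_biUnion_le_card_mul _ _ _ fun y _ => Finset.card_image_le.trans ?_
    rw [hOcard]
    exact h.card_fiber_le _

/-- The main double count of flags. -/
lemma flag_count (h : CertSystem d 𝓕 c) {𝓢 : Finset (Finset α)} (h𝓢 : 𝓢 ⊆ richMembers d L 𝓕 c)
    (hconf : ∀ F ∈ 𝓢, ∀ G ∈ 𝓢, ¬ CertConflict d c F G) :
    d * (𝓕.filter (fun F => (c F).card = d)).card + 𝓢.card * Fintype.card α ≤
      (plainSets d 𝓕 c).card * (Fintype.card α - d) +
        d * (d + 1) ^ (d + 1) * (plainSets d 𝓕 c).card + L * 𝓢.card := by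
  have hin := h.le_card_inner_flags h𝓢
  have hout : ∑ F ∈ 𝓢, (outerFlags d 𝓕 c F).card ≤
      ((flags d 𝓕 c).filter (fun f => insert f.2 f.1 ∉ 𝓕)).card := by
    rw [← Finset.card_biUnion]
    · refine Finset.card_le_card (Finset.biUnion_subset.2 fun F _ f hf => ?_)
      rw [outerFlags, Finset.mem_filter] at hf
      exact Finset.mem_filter.2 ⟨hf.1, hf.2.1⟩
    · intro F hF G hG hFG
      exact h.disjoint_outerFlags (mem_richMembers.1 (h𝓢 hF)).1 (mem_richMembers.1 (h𝓢 hG)).1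
        (hconf F hF G hG) hFG
  have htot := Finset.card_filter_add_card_filter_not (s := flags d 𝓕 c)
    (fun f => insert f.2 f.1 ∈ 𝓕)
  rw [card_flags] at htot
  have hsum : 𝓢.card * Fintype.card α ≤ ∑ F ∈ 𝓢, ((outerFlags d 𝓕 c F).card +
      (fullPoints 𝓕 c F).card + (L + (d + 1))) := by
    rw [← smul_eq_mul]
    exact Finset.card_nsmul_le_sum _ _ _ fun F hF => h.card_le_card_outerFlags_add (h𝓢 hF)
  rw [Finset.sum_add_distrib, Finset.sum_add_distrib, Finset.sum_const, smul_eq_mul] at hsum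
  have hfull := h.sum_card_fullPoints_le h𝓢
  nlinarith

/-- Few members have a small certificate. -/
lemma card_small_cert_le (h : CertSystem d 𝓕 c) (hn : 1 ≤ Fintype.card α) :
    (𝓕.filter (fun F => (c F).card + 2 ≤ d)).card ≤
      d * Fintype.card α ^ (d - 2) * (d + 1) ^ (d + 1) := by
  refine (h.card_le_of_cert_mem (Finset.filter_subset _ _)
    ((Finset.range (d - 1)).biUnion (fun t => Finset.powersetCard t univ)) ?_).trans
    (Nat.mul_le_mul_right _ ?_)
  · intro F hF
    have hF := (Finset.mem_filter.1 hF).2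
    exact Finset.mem_biUnion.2 ⟨(c F).card, Finset.mem_range.2 (by omega),
      Finset.mem_powersetCard.2 ⟨Finset.subset_univ _, rfl⟩⟩
  · refine (Finset.card_biUnion_le_card_mul _ _ (Fintype.card α ^ (d - 2)) fun t ht => ?_).trans
      (Nat.mul_le_mul_right _ ?_)
    · rw [Finset.card_powersetCard, Finset.card_univ]
      rw [Finset.mem_range] at ht
      exact (Nat.choose_le_pow _ _).trans (Nat.pow_le_pow_right hn (by omega))
    · rw [Finset.card_range]
      omega

/-- The members with a certificate of size `d - 1` in many uncovered sets are few compared to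
the uncovered sets. -/
lemma card_poor_mul_le (h : CertSystem d 𝓕 c) (hd : 1 ≤ d) :
    (𝓕.filter (fun F => (c F).card + 1 = d ∧
      L ≤ ((uncovered d 𝓕).filter (fun S => c F ⊆ S)).card)).card * L ≤
      (uncovered d 𝓕).card * d * (d + 1) ^ (d + 1) := by
  set 𝓣 := (univ : Finset (Finset α)).filter (fun T => T.card + 1 = d ∧
    L ≤ ((uncovered d 𝓕).filter (fun S => T ⊆ S)).card) with h𝓣
  have h1 := h.card_le_of_cert_mem (Finset.filter_subset (fun F => (c F).card + 1 = d ∧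
      L ≤ ((uncovered d 𝓕).filter (fun S => c F ⊆ S)).card) 𝓕) 𝓣 fun F hF => by
    rw [h𝓣, Finset.mem_filter]
    exact ⟨Finset.mem_univ _, (Finset.mem_filter.1 hF).2⟩
  have h2 : 𝓣.card * L ≤ (uncovered d 𝓕).card * d := by
    refine Finset.card_mul_le_card_mul (fun T S => T ⊆ S) (fun T hT => ?_) fun S hS => ?_
    · exact (Finset.mem_filter.1 hT).2.2
    · have hScard := (mem_uncovered.1 hS).1
      have hsub : Finset.bipartiteBelow (fun T S => T ⊆ S) 𝓣 S ⊆
          Finset.powersetCard (d - 1) S := by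
        intro T hT
        rw [Finset.mem_bipartiteBelow] at hT
        have := (Finset.mem_filter.1 hT.1).2.1
        exact Finset.mem_powersetCard.2 ⟨hT.2, by omega⟩
      refine (Finset.card_le_card hsub).trans ?_
      rw [Finset.card_powersetCard, hScard]
      rw [← Nat.choose_symm (by omega), Nat.sub_sub_self hd, Nat.choose_one_right]
  calc _ ≤ 𝓣.card * (d + 1) ^ (d + 1) * L := Nat.mul_le_mul_right _ h1
    _ = 𝓣.card * L * (d + 1) ^ (d + 1) := by ring
    _ ≤ _ := Nat.mul_le_mul_right _ h2

lemma card_richMembers_le (h : CertSystem d 𝓕 c) :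
    (richMembers d L 𝓕 c).card ≤ (Fintype.card α) ^ (d - 1) * (d + 1) ^ (d + 1) := by
  refine (h.card_le_of_cert_mem (Finset.filter_subset _ _) (Finset.powersetCard (d - 1) univ)
    fun F hF => ?_).trans (Nat.mul_le_mul_right _ ?_)
  · have := (mem_richMembers.1 hF).2.1
    exact Finset.mem_powersetCard.2 ⟨Finset.subset_univ _, by omega⟩
  · rw [Finset.card_powersetCard, Finset.card_univ]
    exact Nat.choose_le_pow _ _

lemma card_le_add (h : CertSystem d 𝓕 c) (L : ℕ) :
    𝓕.card ≤ (𝓕.filter (fun F => (c F).card = d)).card +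
      (𝓕.filter (fun F => (c F).card + 2 ≤ d)).card +
      (𝓕.filter (fun F => (c F).card + 1 = d ∧
        L ≤ ((uncovered d 𝓕).filter (fun S => c F ⊆ S)).card)).card +
      (richMembers d L 𝓕 c).card := by
  have hsub : 𝓕 ⊆ 𝓕.filter (fun F => (c F).card = d) ∪ 𝓕.filter (fun F => (c F).card + 2 ≤ d) ∪
      𝓕.filter (fun F => (c F).card + 1 = d ∧
        L ≤ ((uncovered d 𝓕).filter (fun S => c F ⊆ S)).card) ∪ richMembers d L 𝓕 c := by
    intro F hF
    have hc := h.card_cert_le hF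
    have hL := le_or_gt L ((uncovered d 𝓕).filter (fun S => c F ⊆ S)).card
    simp only [Finset.mem_union, Finset.mem_filter, mem_richMembers, hF, true_and]
    omega
  refine (Finset.card_le_card hsub).trans ((Finset.card_union_le _ _).trans ?_)
  refine Nat.add_le_add_right ((Finset.card_union_le _ _).trans ?_) _
  exact Nat.add_le_add_right (Finset.card_union_le _ _) _

/-- The upper bound on `d`-certificates and conflict-free rich members, up to lower order terms. -/
lemma card_add_card_le (h : CertSystem d 𝓕 c) (hd : 2 ≤ d) (hn : 1 ≤ Fintype.card α)
    {𝓢 : Finset (Finset α)} (h𝓢 : 𝓢 ⊆ richMembers d L 𝓕 c)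
    (hconf : ∀ F ∈ 𝓢, ∀ G ∈ 𝓢, ¬ CertConflict d c F G) :
    ((𝓕.filter (fun F => (c F).card = d)).card : ℝ) + 𝓢.card ≤
      ((Fintype.card α - 1).choose d : ℝ) - 19 / 20 * (uncovered d 𝓕).card +
        (d * (d + 1) ^ (d + 1) * d + (d * (d + 1) ^ (d + 1) + L) * (d + 1) ^ (d + 1)) *
          (Fintype.card α : ℝ) ^ (d - 2) := by
  have hflag := h.flag_count h𝓢 hconf
  have hpart := h.card_plainSets_add
  have hrich : 𝓢.card ≤ _ := (Finset.card_le_card h𝓢).trans h.card_richMembers_le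
  have hK1 : 20 ≤ (d + 1) ^ (d + 1) := by
    calc 20 ≤ 3 ^ 3 := by norm_num
      _ ≤ 3 ^ (d + 1) := Nat.pow_le_pow_right (by norm_num) (by omega)
      _ ≤ (d + 1) ^ (d + 1) := Nat.pow_le_pow_left (by omega) _
  have hDle := Nat.choose_le_pow (Fintype.card α) d
  have hchoose : (Fintype.card α).choose d * (Fintype.card α - d) =
      (Fintype.card α - 1).choose d * Fintype.card α := by
    have := Nat.choose_mul_succ_eq (Fintype.card α - 1) d
    rw [Nat.sub_add_cancel hn] at this
    exact this.symm
  generalize Fintype.card α = n at *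
  generalize (𝓕.filter (fun F => (c F).card = d)).card = a at *
  generalize 𝓢.card = s at *
  generalize (plainSets d 𝓕 c).card = o at *
  generalize (uncovered d 𝓕).card = m at *
  have hcast : ∀ x : ℕ, x ≤ n.choose d → ((x * (n - d) : ℕ) : ℝ) = x * ((n : ℝ) - d) := by
    intro x hx
    rcases le_or_gt d n with hdn | hdn
    · rw [Nat.cast_mul, Nat.cast_sub hdn]
    · rw [Nat.choose_eq_zero_of_lt hdn, Nat.le_zero] at hx
      simp [hx]
  have hchoose' : (n.choose d : ℝ) * ((n : ℝ) - d) = ((n - 1).choose d : ℝ) * n := by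
    rw [← hcast _ le_rfl, hchoose, Nat.cast_mul]
  have hflag' : (d : ℝ) * a + s * n ≤ o * ((n : ℝ) - d) + d * (d + 1) ^ (d + 1) * o + L * s := by
    rw [← hcast o (by omega)]
    exact_mod_cast hflag
  have hpart' : (o : ℝ) + m + a = n.choose d := by exact_mod_cast hpart
  have hpow : (n : ℝ) ^ (d - 1) = n ^ (d - 2) * n := by
    rw [← pow_succ]
    congr 1
    omega
  have hpow2 : (n : ℝ) ^ d = n ^ (d - 2) * n * n := by
    rw [← pow_succ, ← pow_succ]
    congr 1
    omega
  have hrich' : (s : ℝ) ≤ n ^ (d - 2) * n * (d + 1) ^ (d + 1) := by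
    rw [← hpow]
    exact_mod_cast hrich
  have hDle' : (n.choose d : ℝ) ≤ n ^ (d - 2) * n * n := by
    rw [← hpow2]
    exact_mod_cast hDle
  have hK1' : (20 : ℝ) ≤ ((d : ℝ) + 1) ^ (d + 1) := by exact_mod_cast hK1
  have hn' : (1 : ℝ) ≤ n := by exact_mod_cast hn
  have hN : (0 : ℝ) ≤ n ^ (d - 2) := by positivity
  have hm : (0 : ℝ) ≤ m := Nat.cast_nonneg m
  have hd' : (0 : ℝ) ≤ d := Nat.cast_nonneg d
  have hL : (0 : ℝ) ≤ L := Nat.cast_nonneg L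
  clear hflag hpart hrich hK1 hDle hchoose hcast hpow hpow2
  generalize ((d : ℝ) + 1) ^ (d + 1) = K at *
  generalize (n : ℝ) ^ (d - 2) = N at *
  generalize (n.choose d : ℝ) = D at *
  generalize ((n - 1).choose d : ℝ) = E at *
  generalize (n : ℝ) = x at *
  generalize (d : ℝ) = d at *
  generalize (L : ℝ) = L at *
  generalize (m : ℝ) = m at *
  generalize (a : ℝ) = a at *
  generalize (s : ℝ) = s at *
  have ho : (o : ℝ) = D - m - a := by linarith
  rw [ho] at hflag'
  have hdK : 0 ≤ d * K := by nlinarith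
  have hDE : D - E ≤ d * N * x := by
    have h1 : (D - E) * x ≤ d * N * x * x := by nlinarith
    exact le_of_mul_le_mul_right h1 (by linarith)
  have hs : (d * K + L) * s ≤ (d * K + L) * (N * x * K) :=
    mul_le_mul_of_nonneg_left hrich' (by linarith)
  have hDE' : d * K * (D - E) ≤ d * K * (d * N * x) := mul_le_mul_of_nonneg_left hDE hdK
  have hmd : m * (20 * d) ≤ m * (x + d * K) := mul_le_mul_of_nonneg_left (by nlinarith) hm
  have hB : 0 ≤ (d * K * d + (d * K + L) * K) * N * (d * K) := by
    have : 0 ≤ K := by linarith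
    positivity
  refine le_of_mul_le_mul_right (a := x + d * K) ?_ (by linarith)
  nlinarith

end CertSystem

lemma exists_isMaxCertAssignment {n d : ℕ} {𝓕 : Finset (Finset (Fin n))}
    (hcard : ∀ F ∈ 𝓕, F.card = d + 1) (hVC : VCDimLE 𝓕 d) :
    ∃ c, IsMaxCertAssignment 𝓕 c := by
  classical
  have hex : ∀ F ∈ 𝓕, ∃ T, IsCert 𝓕 F T ∧ ∀ T', IsCert 𝓕 F T' → T'.card ≤ T.card := by
    intro F hF
    have hne : (univ.filter (fun T => IsCert 𝓕 F T)).Nonempty := by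
      have hns : ¬ Shatters' 𝓕 F := fun hsh => by
        have := hVC F hsh
        rw [hcard F hF] at this
        omega
      unfold Shatters' at hns
      push Not at hns
      obtain ⟨A, hAF, hA⟩ := hns
      refine ⟨A, Finset.mem_filter.2 ⟨Finset.mem_univ _, hAF.ssubset_of_ne fun hAe => ?_, hA⟩⟩
      exact hA F hF (by rw [Finset.inter_self, hAe])
    obtain ⟨T, hT, hmax⟩ := Finset.exists_max_image _ Finset.card hne
    exact ⟨T, (Finset.mem_filter.1 hT).2, fun T' hT' =>
      hmax T' (Finset.mem_filter.2 ⟨Finset.mem_univ _, hT'⟩)⟩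
  choose! c hc using hex
  exact ⟨c, hc⟩

lemma IsMaxCertAssignment.certSystem {n d : ℕ} {𝓕 : Finset (Finset (Fin n))}
    {c : Finset (Fin n) → Finset (Fin n)} (hc : IsMaxCertAssignment 𝓕 c)
    (hcard : ∀ F ∈ 𝓕, F.card = d + 1) : CertSystem d 𝓕 c where
  card_eq := hcard
  ssubset F hF := (hc F hF).1.1
  inter_ne F hF := (hc F hF).1.2
  exists_inter_eq F hF v hv hvc := by
    by_contra! hcon
    have hcert : IsCert 𝓕 F (insert v (c F)) := by
      refine ⟨(Finset.insert_subset hv (hc F hF).1.1.1).ssubset_of_ne fun heq => ?_, hcon⟩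
      exact hcon F hF (by rw [Finset.inter_self, heq])
    have := (hc F hF).2 _ hcert
    rw [Finset.card_insert_of_notMem hvc] at this
    omega

lemma compShadow_eq_uncovered {n d : ℕ} {𝓕 : Finset (Finset (Fin n))}
    (hcard : ∀ F ∈ 𝓕, F.card = d + 1) : compShadow d 𝓕 = uncovered d 𝓕 := by
  ext S
  simp only [compShadow, shadow', Finset.mem_sdiff, Finset.mem_powersetCard, Finset.subset_univ,
    true_and, Finset.mem_filter, Finset.mem_univ, CertSystem.mem_uncovered, not_exists, not_and]
  refine and_congr_right fun hS => forall₂_congr fun F hF => ?_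
  simp [hS, hcard F hF]

theorem stmt13 (d : ℕ) (hd : 2 ≤ d) :
    ∃ C : ℝ, ∀ n : ℕ, 1 ≤ n → ∀ 𝓕 : Finset (Finset (Fin n)),
      (∀ F ∈ 𝓕, F.card = d + 1) → VCDimLE 𝓕 d →
      ((compShadow d 𝓕).card : ℝ) ≤
        (10 / 9) * (((n - 1).choose d : ℝ) - (𝓕.card : ℝ) + C * n ^ (d - 2)) := by
  obtain ⟨L, hL⟩ : ∃ L, L = 20 * d * (d + 1) ^ (d + 1) := ⟨_, rfl⟩
  refine ⟨d * (d + 1) ^ (d + 1) * d + (d * (d + 1) ^ (d + 1) + L) * (d + 1) ^ (d + 1) +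
    d * (d + 1) ^ (d + 1) +
    (2 * (d + 1) + L) * (d + 1) ^ (d + 1) * (1 + (d + 1) * (d + 1) ^ (d + 1)),
    fun n hn 𝓕 hcard hVC => ?_⟩
  obtain ⟨c, hc⟩ := exists_isMaxCertAssignment hcard hVC
  have h := hc.certSystem hcard
  have hn' : 1 ≤ Fintype.card (Fin n) := by rwa [Fintype.card_fin]
  rw [compShadow_eq_uncovered hcard]
  have hsmall := h.card_small_cert_le hn'
  have hpoor := h.card_poor_mul_le (L := L) (by omega)
  have hconf := h.card_conflict_le (L := L)
  have hsplit := Finset.card_filter_add_card_filter_not (s := richMembers d L 𝓕 c)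
    (fun F => ∃ G ∈ richMembers d L 𝓕 c, CertConflict d c F G)
  have hmain := h.card_add_card_le hd hn'
    (Finset.filter_subset (fun F => ¬ ∃ G ∈ richMembers d L 𝓕 c, CertConflict d c F G)
      (richMembers d L 𝓕 c))
    fun F hF G hG hFG => (Finset.mem_filter.1 hF).2 ⟨G, (Finset.mem_filter.1 hG).1, hFG⟩
  have htot := h.card_le_add L
  have hchoose := Nat.choose_le_pow (Fintype.card (Fin n)) (d - 2)
  have hconf' := hconf.trans (Nat.mul_le_mul_right _ hchoose)
  have hpoor' : 20 * (𝓕.filter (fun F => (c F).card + 1 = d ∧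
      L ≤ ((uncovered d 𝓕).filter (fun S => c F ⊆ S)).card)).card ≤ (uncovered d 𝓕).card := by
    refine Nat.le_of_mul_le_mul_right ?_ (by positivity : 0 < d * (d + 1) ^ (d + 1))
    calc _ = (𝓕.filter (fun F => (c F).card + 1 = d ∧
          L ≤ ((uncovered d 𝓕).filter (fun S => c F ⊆ S)).card)).card * L := by rw [hL]; ring
      _ ≤ _ := hpoor
      _ = _ := by ring
  rw [Fintype.card_fin] at hsmall hconf' hmain
  rw [← hsplit] at htot
  have htotR := (Nat.cast_le (α := ℝ)).2 htot
  have hsmallR := (Nat.cast_le (α := ℝ)).2 hsmall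
  have hconfR := (Nat.cast_le (α := ℝ)).2 hconf'
  have hpoorR := (Nat.cast_le (α := ℝ)).2 hpoor'
  push_cast at htotR hsmallR hconfR hpoorR
  linarith
end

section
/- For every positive integer d with d ≥ 2 there exists a constant C depending only on d such that the following holds. Let n ≥ 2(d+1) be an integer and let 𝓕 ⊆ binom([n], d+1) be a family of maximum size among all families of (d+1)-element subsets of [n] with VC-dimension at most d. Then |∂̄𝓕| ≤ C·n^{d−2}, where ∂̄𝓕 = binom([n], d) \ ∂𝓕. -/
open Finset

namespace UniformVC

variable {n : ℕ}

/-- The elements `x ∉ D` such that `D ∪ {x}` belongs to `𝓖`. -/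
def ext (𝓖 : Finset (Finset (Fin n))) (D : Finset (Fin n)) : Finset (Fin n) :=
  univ.filter fun x => x ∉ D ∧ insert x D ∈ 𝓖

/-- The elements `x ∉ D` such that `D ∪ {x}` does not belong to `𝓖`. -/
def coext (𝓖 : Finset (Finset (Fin n))) (D : Finset (Fin n)) : Finset (Fin n) :=
  univ.filter fun x => x ∉ D ∧ insert x D ∉ 𝓖

lemma mem_ext {𝓖 : Finset (Finset (Fin n))} {D : Finset (Fin n)} {x : Fin n} :
    x ∈ ext 𝓖 D ↔ x ∉ D ∧ insert x D ∈ 𝓖 := by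
  simp [ext]

lemma mem_coext {𝓖 : Finset (Finset (Fin n))} {D : Finset (Fin n)} {x : Fin n} :
    x ∈ coext 𝓖 D ↔ x ∉ D ∧ insert x D ∉ 𝓖 := by
  simp [coext]

lemma card_ext_add_card_coext (𝓖 : Finset (Finset (Fin n))) (D : Finset (Fin n)) :
    (ext 𝓖 D).card + (coext 𝓖 D).card + D.card = n := by
  have h1 : ext 𝓖 D ∪ coext 𝓖 D = Dᶜ := by
    ext x
    simp only [mem_union, mem_ext, mem_coext, mem_compl]
    tauto
  have h2 : Disjoint (ext 𝓖 D) (coext 𝓖 D) := by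
    rw [Finset.disjoint_left]
    intro x hx hx'
    exact (mem_coext.1 hx').2 (mem_ext.1 hx).2
  rw [← card_union_of_disjoint h2, h1, card_compl_add_card, Fintype.card_fin]

lemma ext_mono {𝓗 𝓖 : Finset (Finset (Fin n))} (h : 𝓗 ⊆ 𝓖) (D : Finset (Fin n)) :
    ext 𝓗 D ⊆ ext 𝓖 D := by
  intro x hx
  rw [mem_ext] at hx ⊢
  exact ⟨hx.1, h hx.2⟩

/-- The star of a point shows that a largest family has at least `binom(n-1, d)` members. -/
lemma choose_le_card_of_maximal {d : ℕ} (hn : 0 < n) {𝓕 : Finset (Finset (Fin n))}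
    (hmax : ∀ 𝓖 : Finset (Finset (Fin n)), (∀ F ∈ 𝓖, F.card = d + 1) → VCDimLE 𝓖 d →
      𝓖.card ≤ 𝓕.card) : (n - 1).choose d ≤ 𝓕.card := by
  let o : Fin n := ⟨0, hn⟩
  let 𝓢 := (powersetCard d (univ.erase o)).image (insert o)
  have hmem : ∀ F ∈ 𝓢, o ∈ F ∧ F.card = d + 1 := by
    intro F hF
    obtain ⟨D, hD, rfl⟩ := mem_image.1 hF
    rw [mem_powersetCard] at hD
    have ho : o ∉ D := fun h => by simpa using hD.1 h
    exact ⟨mem_insert_self _ _, by rw [card_insert_of_notMem ho, hD.2]⟩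
  have hcard : 𝓢.card = (n - 1).choose d := by
    rw [card_image_of_injOn, card_powersetCard, card_erase_of_mem (mem_univ _), card_univ,
      Fintype.card_fin]
    intro D hD D' hD' h
    have ho : ∀ E ∈ powersetCard d (univ.erase o), o ∉ E := fun E hE h => by
      simpa using (mem_powersetCard.1 hE).1 h
    have := congrArg (fun E => E.erase o) h
    simpa [erase_insert (ho D hD), erase_insert (ho D' hD')] using this
  rw [← hcard]
  refine hmax 𝓢 (fun F hF => (hmem F hF).2) fun S hS => ?_
  by_contra hlt
  obtain ⟨F, hF, hFS⟩ := hS S subset_rfl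
  have hSF : S ⊆ F := inter_eq_right.1 hFS
  have hS_eq : S = F := eq_of_subset_of_card_le hSF (by rw [(hmem F hF).2]; omega)
  obtain ⟨G, hG, hGS⟩ := hS ∅ (empty_subset _)
  have : o ∈ G ∩ S := mem_inter.2 ⟨(hmem G hG).1, hS_eq ▸ (hmem F hF).1⟩
  rw [hGS] at this
  simp at this

lemma exists_isMaxCertAssignment {d : ℕ} {𝓕 : Finset (Finset (Fin n))}
    (hcard : ∀ F ∈ 𝓕, F.card = d + 1) (hvc : VCDimLE 𝓕 d) :
    ∃ c, IsMaxCertAssignment 𝓕 c := by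
  have key : ∀ F : Finset (Fin n), ∃ T, F ∈ 𝓕 →
      IsCert 𝓕 F T ∧ ∀ T', IsCert 𝓕 F T' → T'.card ≤ T.card := by
    intro F
    by_cases hF : F ∈ 𝓕
    swap
    · exact ⟨∅, fun h => absurd h hF⟩
    classical
    have hne : (univ.filter (IsCert 𝓕 F)).Nonempty := by
      have hns : ¬ Shatters' 𝓕 F := fun h => by
        have := hvc F h
        rw [hcard F hF] at this
        omega
      simp only [Shatters', not_forall, not_exists, not_and] at hns
      obtain ⟨A, hA, hA'⟩ := hns
      refine ⟨A, mem_filter.2 ⟨mem_univ _, ?_, hA'⟩⟩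
      refine lt_of_le_of_ne hA fun h => hA' F hF ?_
      rw [h, inter_self]
    obtain ⟨T, hT, hTmax⟩ := exists_max_image _ card hne
    exact ⟨T, fun _ => ⟨(mem_filter.1 hT).2, fun T' hT' => hTmax T' (by simp [hT'])⟩⟩
  choose c hc using key
  exact ⟨c, fun F hF => hc F hF⟩

lemma card_filter_maxCert_superset_le {k : ℕ} (hk : 1 ≤ k) {𝓕 : Finset (Finset (Fin n))}
    (hcard : ∀ F ∈ 𝓕, F.card = k) {c : Finset (Fin n) → Finset (Fin n)}
    (hc : IsMaxCertAssignment 𝓕 c) (T : Finset (Fin n)) (m : ℕ) :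
    ∀ X : Finset (Fin n), T ⊆ X → k ≤ X.card + m →
      (𝓕.filter fun F => c F = T ∧ X ⊆ F).card ≤ k ^ m := by
  induction m with
  | zero =>
    intro X _ hX
    rw [pow_zero, card_le_one]
    have key : ∀ F ∈ 𝓕.filter (fun F => c F = T ∧ X ⊆ F), F = X := fun F hF => by
      rw [mem_filter] at hF
      exact (eq_of_subset_of_card_le hF.2.2 (by rw [hcard F hF.1]; omega)).symm
    intro F hF F' hF'
    rw [key F hF, key F' hF']
  | succ m ih =>
    intro X hTX hX
    by_cases h : ∃ G ∈ 𝓕, G ∩ X = T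
    · obtain ⟨G, hG, hGX⟩ := h
      have hsub : (𝓕.filter fun F => c F = T ∧ X ⊆ F) ⊆
          (G \ X).biUnion fun b => 𝓕.filter fun F => c F = T ∧ insert b X ⊆ F := by
        intro F hF
        obtain ⟨hF, hcF, hXF⟩ := mem_filter.1 hF
        have hsubs : T ⊆ G ∩ F := hGX ▸ inter_subset_inter_left hXF
        have hne : ¬ G ∩ F ⊆ T := fun h =>
          (hc F hF).1.2 G hG (by rw [hcF]; exact Subset.antisymm h hsubs)
        obtain ⟨b, hb, hbT⟩ := not_subset.1 hne
        rw [mem_inter] at hb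
        refine mem_biUnion.2 ⟨b, mem_sdiff.2 ⟨hb.1, fun hbX => hbT ?_⟩, ?_⟩
        · rw [← hGX]
          exact mem_inter.2 ⟨hb.1, hbX⟩
        · exact mem_filter.2 ⟨hF, hcF, insert_subset hb.2 hXF⟩
      refine (card_le_card hsub).trans (card_biUnion_le.trans ?_)
      calc ∑ b ∈ G \ X, (𝓕.filter fun F => c F = T ∧ insert b X ⊆ F).card
          ≤ ∑ _b ∈ G \ X, k ^ m := by
            refine sum_le_sum fun b hb => ih _ (hTX.trans (subset_insert _ _)) ?_
            rw [card_insert_of_notMem (mem_sdiff.1 hb).2]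
            omega
        _ = (G \ X).card * k ^ m := by rw [sum_const, smul_eq_mul]
        _ ≤ k * k ^ m := by
            gcongr
            rw [← hcard G hG]
            exact card_le_card sdiff_subset
        _ = k ^ (m + 1) := by rw [pow_succ, mul_comm]
    · refine le_trans ?_ (Nat.one_le_pow _ _ hk)
      rw [card_le_one]
      push Not at h
      have key : ∀ F ∈ 𝓕.filter (fun F => c F = T ∧ X ⊆ F), F = X := fun F hF => by
        obtain ⟨hF, hcF, hXF⟩ := mem_filter.1 hF
        by_contra hne
        have hTF : T ⊆ F := hTX.trans hXF
        have hXT : X ≠ T := fun hXT => h F hF (by rw [hXT, inter_eq_right]; exact hTF)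
        obtain ⟨u, huX, huT⟩ := not_subset.1 fun h' => hXT (Subset.antisymm h' hTX)
        obtain ⟨v, hvF, hvX⟩ := not_subset.1 fun h' => hne (Subset.antisymm h' hXF)
        have hcert : IsCert 𝓕 F (T ∪ F \ X) := by
          refine ⟨⟨union_subset hTF sdiff_subset, fun h' => ?_⟩, fun G hG hGF => h G hG ?_⟩
          · have := h' (hXF huX)
            simp [huT, huX] at this
          · ext y
            have hy := Finset.ext_iff.1 hGF y
            simp only [mem_inter, mem_union, mem_sdiff] at hy ⊢
            constructor
            · rintro ⟨hyG, hyX⟩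
              rcases hy.1 ⟨hyG, hXF hyX⟩ with h1 | h1
              · exact h1
              · exact absurd hyX h1.2
            · intro hyT
              exact ⟨(hy.2 (Or.inl hyT)).1, hTX hyT⟩
        have hle := (hc F hF).2 _ hcert
        rw [hcF] at hle
        have : T ⊂ T ∪ F \ X := by
          refine ⟨subset_union_left, fun h' => hvX (hTX (h' ?_))⟩
          simp [hvF, hvX]
        exact absurd hle (not_le.2 (card_lt_card this))
      intro F hF F' hF'
      rw [key F hF, key F' hF']

/-- A set is a maximum certificate of boundedly many members of a uniform family. -/
lemma card_filter_maxCert_le {k : ℕ} (hk : 1 ≤ k) {𝓕 : Finset (Finset (Fin n))}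
    (hcard : ∀ F ∈ 𝓕, F.card = k) {c : Finset (Fin n) → Finset (Fin n)}
    (hc : IsMaxCertAssignment 𝓕 c) (T : Finset (Fin n)) :
    (𝓕.filter fun F => c F = T).card ≤ k ^ k := by
  refine (card_le_card fun F hF => ?_).trans
    (card_filter_maxCert_superset_le hk hcard hc T k T subset_rfl (by omega))
  rw [mem_filter] at hF ⊢
  exact ⟨hF.1, hF.2, hF.2 ▸ (hc F hF.1).1.1.1⟩

lemma sum_card_ext {d : ℕ} {𝓗 : Finset (Finset (Fin n))} (hcard : ∀ F ∈ 𝓗, F.card = d + 1) :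
    ∑ D ∈ powersetCard d univ, (ext 𝓗 D).card = 𝓗.card * (d + 1) := by
  have h1 : ∀ D ∈ powersetCard d (univ : Finset (Fin n)),
      (ext 𝓗 D).card = (𝓗.filter fun F => D ⊆ F).card := by
    intro D hD
    refine card_bij (fun x _ => insert x D) ?_ ?_ ?_
    · intro x hx
      exact mem_filter.2 ⟨(mem_ext.1 hx).2, subset_insert _ _⟩
    · intro x hx y hy hxy
      have : x ∈ insert y D := hxy ▸ mem_insert_self _ _
      exact (mem_insert.1 this).resolve_right (mem_ext.1 hx).1
    · intro F hF
      obtain ⟨hF, hDF⟩ := mem_filter.1 hF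
      have hc : (F \ D).card = 1 := by
        rw [card_sdiff_of_subset hDF, hcard F hF, (mem_powersetCard.1 hD).2]
        omega
      obtain ⟨x, hx⟩ := card_eq_one.1 hc
      have hx' : x ∈ F \ D := by simp [hx]
      have he : insert x D = F := by
        rw [insert_eq, ← hx, sdiff_union_of_subset hDF]
      exact ⟨x, mem_ext.2 ⟨(mem_sdiff.1 hx').2, he ▸ hF⟩, he⟩
  rw [sum_congr rfl h1]
  have := sum_card_bipartiteAbove_eq_sum_card_bipartiteBelow
    (s := powersetCard d (univ : Finset (Fin n))) (t := 𝓗) (fun D F => D ⊆ F)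
  simp only [bipartiteAbove, bipartiteBelow] at this
  rw [this, ← smul_eq_mul, ← sum_const]
  refine sum_congr rfl fun F hF => ?_
  have : (powersetCard d univ).filter (fun D => D ⊆ F) = powersetCard d F := by
    ext D
    simp only [mem_filter, mem_powersetCard, subset_univ, true_and]
    tauto
  rw [this, card_powersetCard, hcard F hF, Nat.choose_succ_self_right]

/-- The `d`-sets contained in no member of `𝓖`. -/
def bare (d : ℕ) (𝓖 : Finset (Finset (Fin n))) : Finset (Finset (Fin n)) :=
  (powersetCard d univ).filter fun D => (ext 𝓖 D).card = 0

/-- The `d`-sets with at least two one-point extensions in `𝓖`. -/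
def rich (d : ℕ) (𝓖 : Finset (Finset (Fin n))) : Finset (Finset (Fin n)) :=
  (powersetCard d univ).filter fun D => 2 ≤ (ext 𝓖 D).card

lemma mem_bare {d : ℕ} {𝓖 : Finset (Finset (Fin n))} {D : Finset (Fin n)} :
    D ∈ bare d 𝓖 ↔ D.card = d ∧ (ext 𝓖 D).card = 0 := by
  simp [bare, mem_powersetCard]

lemma mem_rich {d : ℕ} {𝓖 : Finset (Finset (Fin n))} {D : Finset (Fin n)} :
    D ∈ rich d 𝓖 ↔ D.card = d ∧ 2 ≤ (ext 𝓖 D).card := by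
  simp [rich, mem_powersetCard]

/-- A certificate of size one less than `F` is contained in no other member. -/
lemma eq_of_isCert_of_subset {d : ℕ} {𝓖 : Finset (Finset (Fin n))} {F G D : Finset (Fin n)}
    (hcard : ∀ F ∈ 𝓖, F.card = d + 1) (hF : F ∈ 𝓖) (hD : IsCert 𝓖 F D) (hDc : D.card = d)
    (hG : G ∈ 𝓖) (hDG : D ⊆ G) : G = F := by
  by_contra hne
  have h1 : D ⊆ G ∩ F := subset_inter hDG hD.1.1
  have h2 : D ⊂ G ∩ F := lt_of_le_of_ne h1 (Ne.symm (hD.2 G hG))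
  have h3 := card_lt_card h2
  have h4 : G ∩ F = F := eq_of_subset_of_card_le inter_subset_right (by rw [hcard F hF]; omega)
  exact hne (eq_of_subset_of_card_le (inter_eq_right.1 h4)
    (by rw [hcard F hF, hcard G hG])).symm

/-- Counting `d`-sets when every member of `𝓗` contains a `d`-set lying in no other member
of `𝓖`. -/
lemma card_private_add_card_bare_le {d : ℕ} {𝓖 𝓗 : Finset (Finset (Fin n))} (hdn : d ≤ n)
    (hcard : ∀ F ∈ 𝓖, F.card = d + 1) (hsub : 𝓗 ⊆ 𝓖)
    (hown : ∀ F ∈ 𝓗, ∃ D, IsCert 𝓖 F D ∧ D.card = d) :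
    n * 𝓗.card + (n - d) * (bare d 𝓖).card + ∑ D ∈ rich d 𝓖, (coext 𝓖 D).card ≤
      (n - d) * n.choose d := by
  classical
  have hown' : ∀ F, ∃ D, F ∈ 𝓗 → IsCert 𝓖 F D ∧ D.card = d := fun F => by
    by_cases hF : F ∈ 𝓗
    · obtain ⟨D, hD⟩ := hown F hF
      exact ⟨D, fun _ => hD⟩
    · exact ⟨∅, fun h => absurd h hF⟩
  choose g hg using hown'
  set A := 𝓗.image g with hA
  have hAcard : A.card = 𝓗.card := by
    refine card_image_of_injOn fun F hF F' hF' h => ?_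
    refine eq_of_isCert_of_subset hcard (hsub hF') (hg F' hF').1 (hg F' hF').2 (hsub hF) ?_
    rw [← h]
    exact (hg F hF).1.1.1
  have hAext : ∀ D ∈ A, D.card = d ∧ (ext 𝓖 D).card = 1 := by
    intro D hD
    obtain ⟨F, hF, rfl⟩ := mem_image.1 hD
    obtain ⟨hcert, hc⟩ := hg F hF
    have hFc := hcard F (hsub hF)
    refine ⟨hc, ?_⟩
    have : ext 𝓖 (g F) = F \ g F := by
      ext x
      rw [mem_ext, mem_sdiff]
      constructor
      · rintro ⟨hx, hxG⟩
        have := eq_of_isCert_of_subset hcard (hsub hF) hcert hc hxG (subset_insert _ _)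
        exact ⟨this ▸ mem_insert_self _ _, hx⟩
      · rintro ⟨hxF, hx⟩
        have : insert x (g F) = F := eq_of_subset_of_card_le
          (insert_subset hxF hcert.1.1) (by rw [card_insert_of_notMem hx]; omega)
        exact ⟨hx, by rw [this]; exact hsub hF⟩
    rw [this, card_sdiff_of_subset hcert.1.1]
    omega
  have hpoint : ∀ D ∈ powersetCard d (univ : Finset (Fin n)),
      (if D ∈ A then n - d else 0) + (ext 𝓗 D).card +
        (if (ext 𝓖 D).card = 0 then n - d else 0) +
        (if 2 ≤ (ext 𝓖 D).card then (coext 𝓖 D).card else 0) ≤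
      (n - d) + if D ∈ A then 1 else 0 := by
    intro D hD
    have h1 := card_le_card (ext_mono hsub D)
    have h2 := card_ext_add_card_coext 𝓖 D
    have h3 := (mem_powersetCard.1 hD).2
    by_cases hDA : D ∈ A
    · have h4 := hAext D hDA
      simp only [hDA, if_true]
      split_ifs <;> omega
    · simp only [hDA, if_false]
      split_ifs <;> omega
  have hsum := sum_le_sum hpoint
  have hAsub : (powersetCard d (univ : Finset (Fin n))).filter (fun D => D ∈ A) = A := by
    ext D
    simp only [mem_filter, mem_powersetCard, subset_univ, true_and]
    exact ⟨fun h => h.2, fun h => ⟨(hAext D h).1, h⟩⟩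
  simp only [sum_add_distrib, ← sum_filter, sum_const, smul_eq_mul, hAsub,
    sum_card_ext fun F hF => hcard F (hsub hF), card_powersetCard, card_univ,
    Fintype.card_fin, mul_one] at hsum
  rw [hAcard] at hsum
  change _ + (bare d 𝓖).card * (n - d) + ∑ D ∈ rich d 𝓖, (coext 𝓖 D).card ≤ _ at hsum
  obtain ⟨m, rfl⟩ := Nat.exists_eq_add_of_le hdn
  simp only [Nat.add_sub_cancel_left] at hsum ⊢
  nlinarith

/-- A subfamily `V` of `𝓖` in which every member `F` has a certificate `c F` of size `d - 1`
shared by at most `κ` members, and all `d`-subsets of `F` are rich. -/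
structure IsCore (d κ : ℕ) (𝓖 V : Finset (Finset (Fin n)))
    (c : Finset (Fin n) → Finset (Fin n)) : Prop where
  card_eq : ∀ F ∈ 𝓖, F.card = d + 1
  subset : V ⊆ 𝓖
  isCert : ∀ F ∈ V, IsCert 𝓖 F (c F)
  card_cert : ∀ F ∈ V, (c F).card + 1 = d
  card_fiber_le : ∀ T, (V.filter fun F => c F = T).card ≤ κ
  mem_rich : ∀ F ∈ V, ∀ D ⊆ F, D.card = d → D ∈ rich d 𝓖

/-- Two sets conflict if their assigned certificates differ and each of the two sets
contains both certificates. -/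
def Conflict (c : Finset (Fin n) → Finset (Fin n)) (F F' : Finset (Fin n)) : Prop :=
  c F ≠ c F' ∧ c F ⊆ F' ∧ c F' ⊆ F

open Classical in
/-- The members of `V` that conflict with some member of `V`. -/
noncomputable def conflicting (V : Finset (Finset (Fin n)))
    (c : Finset (Fin n) → Finset (Fin n)) : Finset (Finset (Fin n)) :=
  V.filter fun F => ∃ F' ∈ V, Conflict c F F'

lemma card_sq_le_of_cover {α β : Type*} [DecidableEq α] {S : Finset α} {M : Finset β}
    {nb : α → Finset α} {Z : β → Finset α} {Δ : ℕ} (hnb : ∀ a ∈ S, (nb a).card ≤ Δ)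
    (hZ : ∀ b ∈ M, (Z b).card ≤ Δ)
    (h : ∀ a ∈ S, ∀ a' ∈ S, a ∈ nb a' ∨ a' ∈ nb a ∨ ∃ b ∈ M, a ∈ Z b ∧ a' ∈ Z b) :
    S.card * S.card ≤ 2 * Δ * S.card + Δ ^ 2 * M.card := by
  have hsub : S ×ˢ S ⊆ (S.biUnion fun a => nb a ×ˢ {a}) ∪ (S.biUnion fun a => {a} ×ˢ nb a) ∪
      M.biUnion fun b => Z b ×ˢ Z b := by
    rintro ⟨a, a'⟩ ha
    rw [mem_product] at ha
    simp only [mem_union, mem_biUnion, mem_product, mem_singleton]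
    rcases h a ha.1 a' ha.2 with h | h | h
    · exact Or.inl (Or.inl ⟨a', ha.2, h, rfl⟩)
    · exact Or.inl (Or.inr ⟨a, ha.1, rfl, h⟩)
    · exact Or.inr h
  have h1 : (S.biUnion fun a => nb a ×ˢ {a}).card ≤ S.card * Δ :=
    card_biUnion_le_card_mul _ _ _ fun a ha => by simpa using hnb a ha
  have h2 : (S.biUnion fun a => {a} ×ˢ nb a).card ≤ S.card * Δ :=
    card_biUnion_le_card_mul _ _ _ fun a ha => by simpa using hnb a ha
  have h3 : (M.biUnion fun b => Z b ×ˢ Z b).card ≤ M.card * (Δ * Δ) :=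
    card_biUnion_le_card_mul _ _ _ fun b hb => by
      rw [card_product]
      exact Nat.mul_le_mul (hZ b hb) (hZ b hb)
  have h4 := card_le_card hsub
  rw [card_product] at h4
  have h5 := card_union_le ((S.biUnion fun a => nb a ×ˢ {a}) ∪
    (S.biUnion fun a => {a} ×ˢ nb a)) (M.biUnion fun b => Z b ×ˢ Z b)
  have h6 := card_union_le (S.biUnion fun a => nb a ×ˢ {a}) (S.biUnion fun a => {a} ×ˢ nb a)
  nlinarith

lemma mul_le_of_sq_le {p Δ m : ℕ} (E : ℕ) (h : p * p ≤ 2 * Δ * p + Δ ^ 2 * m) :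
    E * p ≤ m + E * (2 * Δ + E * Δ ^ 2) := by
  rcases Nat.le_total p (2 * Δ + E * Δ ^ 2) with hp | hp
  · exact (Nat.mul_le_mul_left E hp).trans (Nat.le_add_left _ _)
  · rcases Nat.eq_zero_or_pos Δ with h0 | h0
    · subst h0
      have : p = 0 := by nlinarith
      simp [this]
    · obtain ⟨q, rfl⟩ := Nat.exists_eq_add_of_le hp
      have h1 : Δ ^ 2 * (E * (2 * Δ + E * Δ ^ 2 + q)) ≤ Δ ^ 2 * m := by
        nlinarith [Nat.zero_le (q * (2 * Δ + E * Δ ^ 2 + q))]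
      have := Nat.le_of_mul_le_mul_left h1 (by positivity)
      omega

lemma subset_of_mem_sdiff {R T X : Finset (Fin n)} {y : Fin n} (hRT : R ⊆ T)
    (hT : T.card = R.card + 1) (hyT : y ∈ T) (hyR : y ∉ R) (hRX : R ⊆ X) (hyX : y ∈ X) :
    T ⊆ X := by
  have : insert y R = T := eq_of_subset_of_card_le (insert_subset hyT hRT)
    (by rw [card_insert_of_notMem hyR, hT])
  rw [← this]
  exact insert_subset hyX hRX

lemma mem_of_insert_union_mem {𝓖 : Finset (Finset (Fin n))} {F T T' R : Finset (Fin n)}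
    {y : Fin n} (hcert : IsCert 𝓖 F T) (hRT : R ⊆ T) (hRT' : R ⊆ T')
    (hT' : T'.card = R.card + 1) (hT'F : ¬ T' ⊆ F) (hG : insert y (T ∪ T') ∈ 𝓖) : y ∈ F := by
  by_contra hy
  refine hcert.2 _ hG (Subset.antisymm (fun w hw => ?_) fun w hw => ?_)
  · obtain ⟨hwG, hwF⟩ := mem_inter.1 hw
    rcases mem_insert.1 hwG with rfl | hwG
    · exact absurd hwF hy
    · rcases mem_union.1 hwG with h | h
      · exact h
      · by_contra hwT
        exact hT'F (subset_of_mem_sdiff hRT' hT' h (fun h' => hwT (hRT h'))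
          (hRT.trans hcert.1.1) hwF)
  · exact mem_inter.2 ⟨mem_insert_of_mem (mem_union_left _ hw), hcert.1.1 hw⟩

namespace IsCore

variable {d κ : ℕ} {𝓖 V : Finset (Finset (Fin n))} {c : Finset (Fin n) → Finset (Fin n)}

lemma card_union_inter_of_conflict (h : IsCore d κ 𝓖 V c) {F F' : Finset (Fin n)} (hF : F ∈ V)
    (hF' : F' ∈ V) (hcon : Conflict c F F') :
    F ∩ F' = c F ∪ c F' ∧ (F ∩ F').card = d ∧ (c F ∩ c F').card + 2 = d := by
  have hFc := h.card_eq F (h.subset hF)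
  have hFc' := h.card_eq F' (h.subset hF')
  have hT := h.card_cert F hF
  have hT' := h.card_cert F' hF'
  have h1 : c F ∪ c F' ⊆ F ∩ F' := union_subset
    (subset_inter (h.isCert F hF).1.1 hcon.2.1) (subset_inter hcon.2.2 (h.isCert F' hF').1.1)
  have h2 : c F ⊂ c F ∪ c F' := by
    refine ⟨subset_union_left, fun h' => hcon.1 ?_⟩
    exact (eq_of_subset_of_card_le (subset_union_right.trans h') (by omega)).symm
  have h3 : F ∩ F' ⊂ F := by
    refine ⟨inter_subset_left, fun h' => hcon.1 ?_⟩
    rw [eq_of_subset_of_card_le (h'.trans inter_subset_right) (by omega)]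
  have h4 := card_lt_card h2
  have h5 := card_lt_card h3
  have h6 := card_le_card h1
  have h7 := card_union_add_card_inter (c F) (c F')
  exact ⟨(eq_of_subset_of_card_le h1 (by omega)).symm, by omega, by omega⟩

lemma card_filter_cert_subset_le (h : IsCore d κ 𝓖 V c) (X : Finset (Fin n)) :
    (V.filter fun F => c F ⊆ X).card ≤ 2 ^ X.card * κ := by
  rw [← card_powerset]
  refine (card_le_card fun F hF => ?_).trans
    (card_biUnion_le_card_mul X.powerset (fun T => V.filter fun F => c F = T) κ
      fun T _ => h.card_fiber_le T)
  rw [mem_filter] at hF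
  exact mem_biUnion.2 ⟨c F, mem_powerset.2 hF.2, mem_filter.2 ⟨hF.1, rfl⟩⟩

lemma card_filter_near_le (h : IsCore d κ 𝓖 V c) {W : Finset (Finset (Fin n))} (hW : W ⊆ V)
    {π : Finset (Fin n) → Finset (Fin n)} (hπ : ∀ F ∈ W, π F ∈ V ∧ c F ⊆ π F)
    {X : Finset (Fin n)} {N : ℕ} (hX : X.card ≤ N) :
    (W.filter fun F => c F ⊆ X ∨ c (π F) ⊆ X).card ≤ 2 ^ N * κ * (1 + 2 ^ (d + 1) * κ) := by
  have h0 : 2 ^ X.card ≤ 2 ^ N := Nat.pow_le_pow_right (by norm_num) hX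
  have h1 : (W.filter fun F => c F ⊆ X).card ≤ 2 ^ N * κ :=
    (card_le_card (filter_subset_filter _ hW)).trans
      ((h.card_filter_cert_subset_le X).trans (Nat.mul_le_mul_right _ h0))
  have h2 : (W.filter fun F => c (π F) ⊆ X).card ≤ 2 ^ N * κ * (2 ^ (d + 1) * κ) := by
    have hsub : (W.filter fun F => c (π F) ⊆ X) ⊆
        (V.filter fun F => c F ⊆ X).biUnion fun F' => V.filter fun F => c F ⊆ F' := by
      intro F hF
      rw [mem_filter] at hF
      exact mem_biUnion.2 ⟨π F, mem_filter.2 ⟨(hπ F hF.1).1, hF.2⟩,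
        mem_filter.2 ⟨hW hF.1, (hπ F hF.1).2⟩⟩
    refine (card_le_card hsub).trans ((card_biUnion_le_card_mul _ _ (2 ^ (d + 1) * κ)
      fun F' hF' => ?_).trans ?_)
    · rw [← h.card_eq F' (h.subset (mem_filter.1 hF').1)]
      exact h.card_filter_cert_subset_le F'
    · exact Nat.mul_le_mul_right _
        ((h.card_filter_cert_subset_le X).trans (Nat.mul_le_mul_right _ h0))
  rw [filter_or]
  refine (card_union_le _ _).trans ?_
  nlinarith

/-- Two conflicting pairs with the same common part of certificates, neither of which is close
to the other, produce a bare `d`-set close to both. -/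
lemma exists_mem_bare (h : IsCore d κ 𝓖 V c) {F₁ F₁' F₂ F₂' R : Finset (Fin n)}
    (hF₁ : F₁ ∈ V) (hF₁' : F₁' ∈ V) (hF₂ : F₂ ∈ V) (hF₂' : F₂' ∈ V)
    (hcon₁ : Conflict c F₁ F₁') (hcon₂ : Conflict c F₂ F₂') (hR₁ : c F₁ ∩ c F₁' = R)
    (hR₂ : c F₂ ∩ c F₂' = R)
    (hfar₁ : ¬ (c F₁ ⊆ F₂ ∪ F₂' ∨ c F₁' ⊆ F₂ ∪ F₂'))
    (hfar₂ : ¬ (c F₂ ⊆ F₁ ∪ F₁' ∨ c F₂' ⊆ F₁ ∪ F₁')) :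
    ∃ D ∈ bare d 𝓖, R ⊆ D ∧ c F₁ ⊆ D ∧ (c F₂ ⊆ D ∨ c F₂' ⊆ D) := by
  push Not at hfar₁ hfar₂
  obtain ⟨hI₁, hIc₁, hRc₁⟩ := h.card_union_inter_of_conflict hF₁ hF₁' hcon₁
  obtain ⟨hI₂, hIc₂, hRc₂⟩ := h.card_union_inter_of_conflict hF₂ hF₂' hcon₂
  have hT₁ := h.card_cert F₁ hF₁
  have hT₁' := h.card_cert F₁' hF₁'
  have hT₂ := h.card_cert F₂ hF₂
  have hT₂' := h.card_cert F₂' hF₂'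
  rw [hR₁] at hRc₁
  have r₁ : R ⊆ c F₁ := hR₁ ▸ inter_subset_left
  have r₁' : R ⊆ c F₁' := hR₁ ▸ inter_subset_right
  have r₂ : R ⊆ c F₂ := hR₂ ▸ inter_subset_left
  have r₂' : R ⊆ c F₂' := hR₂ ▸ inter_subset_right
  have n₁₂ : ¬ c F₁ ⊆ F₂ := fun h' => hfar₁.1 (h'.trans subset_union_left)
  have n₁₂' : ¬ c F₁ ⊆ F₂' := fun h' => hfar₁.1 (h'.trans subset_union_right)
  have n₁'₂ : ¬ c F₁' ⊆ F₂ := fun h' => hfar₁.2 (h'.trans subset_union_left)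
  have n₁'₂' : ¬ c F₁' ⊆ F₂' := fun h' => hfar₁.2 (h'.trans subset_union_right)
  have n₂₁ : ¬ c F₂ ⊆ F₁ := fun h' => hfar₂.1 (h'.trans subset_union_left)
  have n₂'₁ : ¬ c F₂' ⊆ F₁ := fun h' => hfar₂.2 (h'.trans subset_union_left)
  have hcert₁ := h.isCert F₁ hF₁
  have hcert₂ := h.isCert F₂ hF₂
  have hcert₂' := h.isCert F₂' hF₂'
  have hcardD : ∀ T, R ⊆ T → T.card + 1 = d → ¬ T ⊆ F₁ → (c F₁ ∪ T).card = d := by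
    intro T hRT hT hTF
    have hinter : c F₁ ∩ T = R := by
      refine (Subset.antisymm (fun y hy => ?_) (subset_inter r₁ hRT))
      by_contra hyR
      rw [mem_inter] at hy
      exact hTF (subset_of_mem_sdiff hRT (by omega) hy.2 hyR (r₁.trans hcert₁.1.1)
        (hcert₁.1.1 hy.1))
    have := card_union_add_card_inter (c F₁) T
    rw [hinter] at this
    omega
  have hbare : ∀ D, D.card = d → D ∉ bare d 𝓖 → ∃ y, y ∉ D ∧ insert y D ∈ 𝓖 := by
    intro D hD hDb
    have : (ext 𝓖 D).Nonempty := by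
      rw [← card_ne_zero]
      exact fun h0 => hDb (mem_bare.2 ⟨hD, h0⟩)
    obtain ⟨y, hy⟩ := this
    exact ⟨y, mem_ext.1 hy⟩
  by_cases hb₁ : c F₁ ∪ c F₂ ∈ bare d 𝓖
  · exact ⟨_, hb₁, r₁.trans subset_union_left, subset_union_left, Or.inl subset_union_right⟩
  by_cases hb₂ : c F₁ ∪ c F₂' ∈ bare d 𝓖
  · exact ⟨_, hb₂, r₁.trans subset_union_left, subset_union_left, Or.inr subset_union_right⟩
  exfalso
  obtain ⟨y, hy, hG⟩ := hbare _ (hcardD _ r₂ hT₂ n₂₁) hb₁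
  obtain ⟨z, hz, hG'⟩ := hbare _ (hcardD _ r₂' hT₂' n₂'₁) hb₂
  have y₁ : y ∈ F₁ := mem_of_insert_union_mem hcert₁ r₁ r₂ (by omega) n₂₁ hG
  have y₂ : y ∈ F₂ := mem_of_insert_union_mem hcert₂ r₂ r₁ (by omega) n₁₂
    (by rw [union_comm]; exact hG)
  have z₁ : z ∈ F₁ := mem_of_insert_union_mem hcert₁ r₁ r₂' (by omega) n₂'₁ hG'
  have z₂' : z ∈ F₂' := mem_of_insert_union_mem hcert₂' r₂' r₁ (by omega) n₁₂'
    (by rw [union_comm]; exact hG')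
  rw [mem_union, not_or] at hy hz
  have hy' : y ∉ c F₁' := fun h' => n₁'₂ (subset_of_mem_sdiff r₁' (by omega) h'
    (fun h'' => hy.1 (r₁ h'')) (r₂.trans hcert₂.1.1) y₂)
  have hz' : z ∉ c F₁' := fun h' => n₁'₂' (subset_of_mem_sdiff r₁' (by omega) h'
    (fun h'' => hz.1 (r₁ h'')) (r₂'.trans hcert₂'.1.1) z₂')
  have hone : (F₁ \ (F₁ ∩ F₁')).card = 1 := by
    rw [card_sdiff_of_subset inter_subset_left, h.card_eq F₁ (h.subset hF₁), hIc₁]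
    omega
  rw [hI₁] at hone
  have hyz : y = z := card_le_one.1 hone.le y (by simp [y₁, hy.1, hy']) z
    (by simp [z₁, hz.1, hz'])
  have : y ∈ F₂ ∩ F₂' := mem_inter.2 ⟨y₂, hyz ▸ z₂'⟩
  rw [hI₂, mem_union] at this
  rcases this with h' | h'
  · exact hy.2 h'
  · exact hz.2 (hyz ▸ h')

/-- The number of sets close to a given set of size at most `2 * (d + 1)`. -/
def nearBound (d κ : ℕ) : ℕ := 2 ^ (2 * (d + 1)) * κ * (1 + 2 ^ (d + 1) * κ)

lemma card_conflicting_le (h : IsCore d κ 𝓖 V c) :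
    4 * (conflicting V c).card ≤ (bare d 𝓖).card +
      4 * (2 * nearBound d κ + 4 * 2 ^ d * nearBound d κ ^ 2) * n ^ (d - 2) := by
  classical
  set W := conflicting V c with hWdef
  have hWV : W ⊆ V := filter_subset _ _
  have hpartner : ∀ F, ∃ F', F ∈ W → F' ∈ V ∧ Conflict c F F' := fun F => by
    by_cases hF : F ∈ W
    · obtain ⟨F', h'⟩ := (mem_filter.1 hF).2
      exact ⟨F', fun _ => h'⟩
    · exact ⟨∅, fun h' => absurd h' hF⟩
  choose π hπ using hpartner
  set Δ := nearBound d κ with hΔ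
  let near (X : Finset (Fin n)) := W.filter fun F => c F ⊆ X ∨ c (π F) ⊆ X
  have hnear : ∀ X : Finset (Fin n), X.card ≤ 2 * (d + 1) → (near X).card ≤ Δ := fun X hX =>
    h.card_filter_near_le hWV (fun F hF => ⟨(hπ F hF).1, (hπ F hF).2.2.1⟩) hX
  let fib (R : Finset (Fin n)) := W.filter fun F => c F ∩ c (π F) = R
  let sup (R : Finset (Fin n)) := (bare d 𝓖).filter fun D => R ⊆ D
  set E := 4 * 2 ^ d with hE
  have hfib : ∀ R, E * (fib R).card ≤ (sup R).card + E * (2 * Δ + E * Δ ^ 2) := by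
    intro R
    refine mul_le_of_sq_le E (card_sq_le_of_cover (nb := fun F => near (F ∪ π F)) (Z := near)
      (fun F hF => hnear _ ?_) (fun D hD => hnear D ?_) fun F₁ hF₁ F₂ hF₂ => ?_)
    · have hFW := (mem_filter.1 hF).1
      have := card_union_le F (π F)
      rw [h.card_eq F (h.subset (hWV hFW)), h.card_eq _ (h.subset (hπ F hFW).1)] at this
      omega
    · have := (mem_bare.1 (mem_filter.1 hD).1).1
      omega
    · obtain ⟨hW₁, hR₁⟩ := mem_filter.1 hF₁
      obtain ⟨hW₂, hR₂⟩ := mem_filter.1 hF₂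
      by_cases hfar₁ : c F₁ ⊆ F₂ ∪ π F₂ ∨ c (π F₁) ⊆ F₂ ∪ π F₂
      · exact Or.inl (mem_filter.2 ⟨hW₁, hfar₁⟩)
      by_cases hfar₂ : c F₂ ⊆ F₁ ∪ π F₁ ∨ c (π F₂) ⊆ F₁ ∪ π F₁
      · exact Or.inr (Or.inl (mem_filter.2 ⟨hW₂, hfar₂⟩))
      obtain ⟨D, hD, hRD, hD₁, hD₂⟩ := h.exists_mem_bare (hWV hW₁) (hπ _ hW₁).1 (hWV hW₂)
        (hπ _ hW₂).1 (hπ _ hW₁).2 (hπ _ hW₂).2 hR₁ hR₂ hfar₁ hfar₂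
      exact Or.inr (Or.inr ⟨D, mem_filter.2 ⟨hD, hRD⟩, mem_filter.2 ⟨hW₁, Or.inl hD₁⟩,
        mem_filter.2 ⟨hW₂, hD₂⟩⟩)
  have hWsum : W.card = ∑ R ∈ powersetCard (d - 2) univ, (fib R).card := by
    refine card_eq_sum_card_fiberwise fun F hF => ?_
    have := (h.card_union_inter_of_conflict (hWV hF) (hπ F hF).1 (hπ F hF).2).2.2
    exact mem_coe.2 (mem_powersetCard.2 ⟨subset_univ _, by omega⟩)
  have hsup : ∑ R ∈ powersetCard (d - 2) univ, (sup R).card ≤ (bare d 𝓖).card * 2 ^ d := by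
    have := sum_card_bipartiteAbove_eq_sum_card_bipartiteBelow
      (s := powersetCard (d - 2) (univ : Finset (Fin n))) (t := bare d 𝓖) (fun R D => R ⊆ D)
    simp only [bipartiteAbove, bipartiteBelow] at this
    rw [this, ← smul_eq_mul]
    refine sum_le_card_nsmul _ _ _ fun D hD => ?_
    rw [← (mem_bare.1 hD).1, ← card_powerset]
    exact card_le_card fun R hR => mem_powerset.2 (mem_filter.1 hR).2
  have hsum := sum_le_sum fun R (_ : R ∈ powersetCard (d - 2) (univ : Finset (Fin n))) => hfib R
  rw [← mul_sum, ← hWsum, sum_add_distrib, sum_const, smul_eq_mul, card_powersetCard, card_univ,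
    Fintype.card_fin] at hsum
  have hchoose := Nat.mul_le_mul_right (E * (2 * Δ + E * Δ ^ 2)) (Nat.choose_le_pow n (d - 2))
  have hfinal : 2 ^ d * (4 * W.card) ≤
      2 ^ d * ((bare d 𝓖).card + 4 * (2 * Δ + E * Δ ^ 2) * n ^ (d - 2)) := by
    calc 2 ^ d * (4 * W.card) = E * W.card := by rw [hE]; ring
      _ ≤ (bare d 𝓖).card * 2 ^ d + n ^ (d - 2) * (E * (2 * Δ + E * Δ ^ 2)) := by omega
      _ = 2 ^ d * ((bare d 𝓖).card + 4 * (2 * Δ + E * Δ ^ 2) * n ^ (d - 2)) := by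
        rw [hE]; ring
  exact Nat.le_of_mul_le_mul_left hfinal (by positivity)

lemma mono (h : IsCore d κ 𝓖 V c) {U : Finset (Finset (Fin n))} (hU : U ⊆ V) :
    IsCore d κ 𝓖 U c where
  card_eq := h.card_eq
  subset := hU.trans h.subset
  isCert F hF := h.isCert F (hU hF)
  card_cert F hF := h.card_cert F (hU hF)
  card_fiber_le T := (card_le_card (filter_subset_filter _ hU)).trans (h.card_fiber_le T)
  mem_rich F hF := h.mem_rich F (hU hF)

open Classical in
/-- The `d`-sets lying between a member of `V` and its certificate `T`. -/
noncomputable def between (d : ℕ) (V : Finset (Finset (Fin n)))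
    (c : Finset (Fin n) → Finset (Fin n)) (T : Finset (Fin n)) : Finset (Finset (Fin n)) :=
  (powersetCard d univ).filter fun D => ∃ F ∈ V, c F = T ∧ T ⊆ D ∧ D ⊆ F

/-- The `d`-sets with exactly two one-point extensions in `𝓖`. -/
def linking (d : ℕ) (𝓖 : Finset (Finset (Fin n))) : Finset (Finset (Fin n)) :=
  (powersetCard d univ).filter fun D => (ext 𝓖 D).card = 2

lemma mem_between {T D : Finset (Fin n)} :
    D ∈ between d V c T ↔ D.card = d ∧ ∃ F ∈ V, c F = T ∧ T ⊆ D ∧ D ⊆ F := by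
  simp [between, mem_powersetCard]

lemma mem_linking {D : Finset (Fin n)} :
    D ∈ linking d 𝓖 ↔ D.card = d ∧ (ext 𝓖 D).card = 2 := by
  simp [linking, mem_powersetCard]

lemma exists_mem_inter_sdiff {F G T : Finset (Fin n)} (hcert : IsCert 𝓖 F T) (hG : G ∈ 𝓖)
    (hTG : T ⊆ G) : ∃ x, x ∈ G ∧ x ∈ F ∧ x ∉ T := by
  by_contra! hne
  exact hcert.2 G hG (Subset.antisymm (fun x hx => by
    by_contra hxT
    exact hxT (hne x (mem_inter.1 hx).1 (mem_inter.1 hx).2)) (subset_inter hTG hcert.1.1))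

/-- A `d`-set containing a certificate `T` of `F` and not contained in `F` has only the
elements of `F \ T` as one-point extensions. -/
lemma ext_subset_sdiff {F D T : Finset (Fin n)} (hcert : IsCert 𝓖 F T) (hTD : T ⊆ D)
    (hD : D.card = T.card + 1) (hDF : ¬ D ⊆ F) : ext 𝓖 D ⊆ F \ T := by
  intro x hx
  obtain ⟨hxD, hG⟩ := mem_ext.1 hx
  obtain ⟨w, hwG, hwF, hwT⟩ := exists_mem_inter_sdiff hcert hG
    (hTD.trans (subset_insert _ _))
  rcases mem_insert.1 hwG with rfl | hwD
  · exact mem_sdiff.2 ⟨hwF, hwT⟩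
  · exact absurd (subset_of_mem_sdiff hTD hD hwD hwT hcert.1.1 hwF) hDF

lemma sub_le_card_coext (h : IsCore d κ 𝓖 V c) {F D : Finset (Fin n)} (hF : F ∈ V)
    (hTD : c F ⊆ D) (hD : D.card = d) (hDF : ¬ D ⊆ F) : n - d - 2 ≤ (coext 𝓖 D).card := by
  have hT := h.card_cert F hF
  have hcert := h.isCert F hF
  have h1 := card_le_card (ext_subset_sdiff hcert hTD (by omega) hDF)
  rw [card_sdiff_of_subset hcert.1.1, h.card_eq F (h.subset hF)] at h1
  have h2 := card_ext_add_card_coext 𝓖 D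
  omega

lemma exists_eq_insert_insert {F T : Finset (Fin n)} (hTF : T ⊆ F) (hc : F.card = T.card + 2) :
    ∃ a b, a ∉ T ∧ b ∉ T ∧ a ≠ b ∧ F = insert a (insert b T) := by
  obtain ⟨a, b, hab, he⟩ := card_eq_two.1
    (show (F \ T).card = 2 by rw [card_sdiff_of_subset hTF]; omega)
  have ha : a ∈ F \ T := by simp [he]
  have hb : b ∈ F \ T := by simp [he]
  refine ⟨a, b, (mem_sdiff.1 ha).2, (mem_sdiff.1 hb).2, hab, ?_⟩
  rw [← sdiff_union_of_subset hTF, he]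
  ext x
  simp

/-- Members sharing a certificate `T` intersect pairwise outside `T`, so as soon as there are
two of them, at least as many `d`-sets as members lie between `T` and a member without being
contained in all members. -/
lemma card_fiber_le_card_between (h : IsCore d κ 𝓖 V c) {T : Finset (Fin n)}
    (htwo : 2 ≤ (V.filter fun F => c F = T).card) :
    (V.filter fun F => c F = T).card ≤
      ((between d V c T).filter fun D => ∃ F ∈ V, c F = T ∧ ¬ D ⊆ F).card := by
  set S := V.filter fun F => c F = T with hS
  have hcert : ∀ F ∈ S, IsCert 𝓖 F T := fun F hF => by
    rw [mem_filter] at hF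
    exact hF.2 ▸ h.isCert F hF.1
  have hcardF : ∀ F ∈ S, F.card = d + 1 := fun F hF =>
    h.card_eq F (h.subset (mem_filter.1 hF).1)
  have hcardT : T.card + 1 = d := by
    obtain ⟨F, hF⟩ := card_pos.1 (by omega : 0 < S.card)
    rw [mem_filter] at hF
    exact hF.2 ▸ h.card_cert F hF.1
  have hmeet : ∀ F ∈ S, ∀ F' ∈ S, ∃ x, x ∈ F ∧ x ∈ F' ∧ x ∉ T := fun F hF F' hF' =>
    exists_mem_inter_sdiff (hcert F' hF') (h.subset (mem_filter.1 hF).1) (hcert F hF).1.1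
  have heq : ∀ F ∈ S, ∀ F' ∈ S, F ⊆ F' → F = F' := fun F hF F' hF' hle =>
    eq_of_subset_of_card_le hle (by rw [hcardF F hF, hcardF F' hF'])
  have hmem : ∀ D, D.card = d → T ⊆ D → (∃ F ∈ S, D ⊆ F) → (∃ F ∈ S, ¬ D ⊆ F) →
      D ∈ (between d V c T).filter fun D => ∃ F ∈ V, c F = T ∧ ¬ D ⊆ F := by
    rintro D hD hTD ⟨F, hF, hDF⟩ ⟨F', hF', hDF'⟩
    rw [mem_filter] at hF hF'
    exact mem_filter.2 ⟨mem_between.2 ⟨hD, F, hF.1, hF.2, hTD, hDF⟩, F', hF'.1, hF'.2, hDF'⟩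
  by_cases hstar : ∃ a, a ∉ T ∧ ∀ F ∈ S, a ∈ F
  · obtain ⟨a, haT, ha⟩ := hstar
    refine card_le_card_of_injOn (fun F => F.erase a) (fun F hF => ?_) fun F hF F' hF' he => ?_
    · have hF : F ∈ S := hF
      obtain ⟨F', hF', hne⟩ := exists_mem_ne (by omega : 1 < S.card) F
      refine hmem _ (by rw [card_erase_of_mem (ha F hF), hcardF F hF]; omega)
        (subset_erase.2 ⟨(hcert F hF).1.1, haT⟩) ⟨F, hF, erase_subset _ _⟩ ⟨F', hF', fun hle => ?_⟩
      refine hne (heq F hF F' hF' ?_).symm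
      rw [← insert_erase (ha F hF)]
      exact insert_subset (ha F' hF') hle
    · have he : F.erase a = F'.erase a := he
      rw [← insert_erase (ha F hF), he, insert_erase (ha F' hF')]
  · push Not at hstar
    obtain ⟨F₀, hF₀⟩ := card_pos.1 (by omega : 0 < S.card)
    have hT₀ := hcardF F₀ hF₀
    obtain ⟨a, b, haT, hbT, hab, hF₀e⟩ := exists_eq_insert_insert (hcert F₀ hF₀).1.1 (by omega)
    obtain ⟨F₁, hF₁, ha₁⟩ := hstar a haT
    obtain ⟨F₂, hF₂, hb₂⟩ := hstar b hbT
    have hmeet₀ : ∀ F ∈ S, a ∈ F ∨ b ∈ F := fun F hF => by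
      obtain ⟨x, hx₀, hxF, hxT⟩ := hmeet F₀ hF₀ F hF
      rw [hF₀e, mem_insert, mem_insert] at hx₀
      rcases hx₀ with rfl | rfl | hx
      · exact Or.inl hxF
      · exact Or.inr hxF
      · exact absurd hx hxT
    have hb₁ := (hmeet₀ F₁ hF₁).resolve_left ha₁
    have ha₂ := (hmeet₀ F₂ hF₂).resolve_right hb₂
    obtain ⟨u, hu₁, hu₂, huT⟩ := hmeet F₁ hF₁ F₂ hF₂
    have hau : a ≠ u := fun h' => ha₁ (h' ▸ hu₁)
    have hbu : b ≠ u := fun h' => hb₂ (h' ▸ hu₂)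
    have hpair : ∀ F ∈ S, ∀ x y, x ∉ T → y ∉ T → x ≠ y → x ∈ F → y ∈ F →
        F = insert x (insert y T) := by
      intro F hF x y hx hy hxy hxF hyF
      refine (eq_of_subset_of_card_le (insert_subset hxF (insert_subset hyF (hcert F hF).1.1))
        ?_).symm
      rw [card_insert_of_notMem (by simp [hxy, hx]), card_insert_of_notMem hy, hcardF F hF]
      omega
    have hu₀ : u ∉ F₀ := by
      rw [hF₀e]
      simp [hau.symm, hbu.symm, huT]
    have hS3 : S ⊆ {F₀, F₁, F₂} := by
      intro F hF
      simp only [mem_insert, mem_singleton]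
      have e₀ : a ∈ F → b ∈ F → F = F₀ := fun h₁ h₂ => by
        rw [hF₀e, hpair F hF a b haT hbT hab h₁ h₂]
      have e₁ : b ∈ F → u ∈ F → F = F₁ := fun h₁ h₂ => by
        rw [hpair F hF b u hbT huT hbu h₁ h₂, hpair F₁ hF₁ b u hbT huT hbu hb₁ hu₁]
      have e₂ : a ∈ F → u ∈ F → F = F₂ := fun h₁ h₂ => by
        rw [hpair F hF a u haT huT hau h₁ h₂, hpair F₂ hF₂ a u haT huT hau ha₂ hu₂]
      have m₁ : b ∈ F ∨ u ∈ F := by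
        obtain ⟨x, hx, hxF, hxT⟩ := hmeet F₁ hF₁ F hF
        rw [hpair F₁ hF₁ b u hbT huT hbu hb₁ hu₁, mem_insert, mem_insert] at hx
        rcases hx with rfl | rfl | hx
        · exact Or.inl hxF
        · exact Or.inr hxF
        · exact absurd hx hxT
      have m₂ : a ∈ F ∨ u ∈ F := by
        obtain ⟨x, hx, hxF, hxT⟩ := hmeet F₂ hF₂ F hF
        rw [hpair F₂ hF₂ a u haT huT hau ha₂ hu₂, mem_insert, mem_insert] at hx
        rcases hx with rfl | rfl | hx
        · exact Or.inl hxF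
        · exact Or.inr hxF
        · exact absurd hx hxT
      have m₀ := hmeet₀ F hF
      tauto
    have hnotin : ∀ x ∉ T, ∀ y, x ≠ y → insert x T ≠ insert y T := fun x hx y hxy he => by
      have : x ∈ insert y T := he ▸ mem_insert_self x T
      exact (mem_insert.1 this).elim hxy hx
    have hthree : ({insert a T, insert b T, insert u T} : Finset (Finset (Fin n))).card = 3 :=
      card_eq_three.2 ⟨_, _, _, hnotin a haT b hab, hnotin a haT u hau, hnotin b hbT u hbu, rfl⟩
    have hins : ∀ x ∉ T, (∃ F ∈ S, x ∈ F) → (∃ F ∈ S, x ∉ F) → insert x T ∈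
        (between d V c T).filter fun D => ∃ F ∈ V, c F = T ∧ ¬ D ⊆ F := by
      rintro x hx ⟨F, hF, hxF⟩ ⟨F', hF', hxF'⟩
      exact hmem _ (by rw [card_insert_of_notMem hx, hcardT]) (subset_insert _ _)
        ⟨F, hF, insert_subset hxF (hcert F hF).1.1⟩
        ⟨F', hF', fun h' => hxF' (h' (mem_insert_self _ _))⟩
    calc S.card ≤ 3 := (card_le_card hS3).trans card_le_three
      _ = _ := hthree.symm
      _ ≤ _ := by
        refine card_le_card fun D hD => ?_
        simp only [mem_insert, mem_singleton] at hD
        rcases hD with rfl | rfl | rfl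
        · exact hins a haT ⟨F₂, hF₂, ha₂⟩ ⟨F₁, hF₁, ha₁⟩
        · exact hins b hbT ⟨F₁, hF₁, hb₁⟩ ⟨F₂, hF₂, hb₂⟩
        · exact hins u huT ⟨F₁, hF₁, hu₁⟩ ⟨F₀, hF₀, hu₀⟩

lemma between_subset_rich (h : IsCore d κ 𝓖 V c) (T : Finset (Fin n)) :
    between d V c T ⊆ rich d 𝓖 := fun D hD => by
  obtain ⟨hDc, F, hF, -, -, hDF⟩ := mem_between.1 hD
  exact h.mem_rich F hF D hDF hDc

/-- A member with a certificate `T` of its own: almost every point contributes a missing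
extension or a linking `d`-set. -/
lemma sub_le_of_mem (h : IsCore d κ 𝓖 V c) {F : Finset (Fin n)} (hF : F ∈ V) :
    n - d - 2 ≤ ∑ D ∈ between d V c (c F), (coext 𝓖 D).card +
      ((linking d 𝓖).filter fun D => c F ⊆ D).card := by
  have hcert := h.isCert F hF
  have hT := h.card_cert F hF
  have hFc := h.card_eq F (h.subset hF)
  obtain ⟨a, b, haT, hbT, hab, he⟩ := exists_eq_insert_insert hcert.1.1 (by omega)
  set T := c F with hTdef
  have haF : a ∈ F := by simp [he]
  have hbF : b ∈ F := by simp [he]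
  have hbtw : ∀ x ∉ T, x ∈ F → insert x T ∈ between d V c T := fun x hx hxF =>
    mem_between.2 ⟨by rw [card_insert_of_notMem hx, hT], F, hF, rfl, subset_insert _ _,
      insert_subset hxF hcert.1.1⟩
  have hsub : Fᶜ ⊆ (coext 𝓖 (insert a T) ∪ coext 𝓖 (insert b T)) ∪
      Fᶜ.filter fun y => insert y T ∈ linking d 𝓖 := by
    intro y hy
    have hyF := mem_compl.1 hy
    have hyT : y ∉ T := fun h' => hyF (hcert.1.1 h')
    have hya : y ≠ a := fun h' => hyF (h' ▸ haF)
    have hyb : y ≠ b := fun h' => hyF (h' ▸ hbF)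
    by_cases hGa : insert y (insert a T) ∈ 𝓖
    swap
    · exact mem_union_left _ (mem_union_left _ (mem_coext.2 ⟨by simp [hya, hyT], hGa⟩))
    by_cases hGb : insert y (insert b T) ∈ 𝓖
    swap
    · exact mem_union_left _ (mem_union_right _ (mem_coext.2 ⟨by simp [hyb, hyT], hGb⟩))
    refine mem_union_right _ (mem_filter.2 ⟨hy, mem_linking.2 ⟨?_, ?_⟩⟩)
    · rw [card_insert_of_notMem hyT, hT]
    · have hle := ext_subset_sdiff hcert (subset_insert y T) (card_insert_of_notMem hyT)
        fun h' => hyF (h' (mem_insert_self _ _))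
      have hge : F \ T ⊆ ext 𝓖 (insert y T) := by
        intro x hx
        rw [mem_sdiff, he, mem_insert, mem_insert] at hx
        rcases hx with ⟨rfl | rfl | hx, hxT⟩
        · exact mem_ext.2 ⟨by simp [hya.symm, hxT], by rwa [insert_comm]⟩
        · exact mem_ext.2 ⟨by simp [hyb.symm, hxT], by rwa [insert_comm]⟩
        · exact absurd hx hxT
      rw [Subset.antisymm hle hge, card_sdiff_of_subset hcert.1.1]
      omega
  have h1 := card_le_card hsub
  rw [card_compl, Fintype.card_fin, hFc] at h1
  have h2 := card_union_le (coext 𝓖 (insert a T) ∪ coext 𝓖 (insert b T))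
    (Fᶜ.filter fun y => insert y T ∈ linking d 𝓖)
  have h3 := card_union_le (coext 𝓖 (insert a T)) (coext 𝓖 (insert b T))
  have h4 : (Fᶜ.filter fun y => insert y T ∈ linking d 𝓖).card ≤
      ((linking d 𝓖).filter fun D => T ⊆ D).card := by
    refine card_le_card_of_injOn (fun y => insert y T) (fun y hy => ?_) fun y hy z hz hyz => ?_
    · exact mem_coe.2 (mem_filter.2 ⟨(mem_filter.1 hy).2, subset_insert _ _⟩)
    · have hyT : y ∉ T := fun h' => mem_compl.1 (mem_filter.1 hy).1 (hcert.1.1 h')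
      have : y ∈ insert z T := (show insert y T = insert z T from hyz) ▸ mem_insert_self y T
      exact (mem_insert.1 this).resolve_right hyT
  have hne : insert a T ≠ insert b T := fun h' => by
    have : a ∈ insert b T := h' ▸ mem_insert_self a T
    exact (mem_insert.1 this).elim hab haT
  have h5 : ∑ D ∈ {insert a T, insert b T}, (coext 𝓖 D).card ≤
      ∑ D ∈ between d V c T, (coext 𝓖 D).card := by
    refine sum_le_sum_of_subset fun D hD => ?_
    rcases mem_insert.1 hD with rfl | hD
    · exact hbtw a haT haF
    · exact mem_singleton.1 hD ▸ hbtw b hbT hbF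
  rw [sum_pair hne] at h5
  omega

lemma card_fiber_mul_le (h : IsCore d κ 𝓖 V c) (T : Finset (Fin n)) :
    (V.filter fun F => c F = T).card * (n - d - 2) ≤
      ∑ D ∈ between d V c T, (coext 𝓖 D).card +
        ((linking d 𝓖).filter fun D => T ⊆ D).card := by
  rcases Nat.lt_or_ge (V.filter fun F => c F = T).card 2 with hlt | htwo
  · rcases Nat.eq_zero_or_pos (V.filter fun F => c F = T).card with h0 | hpos
    · simp [h0]
    · obtain ⟨F, hF⟩ := card_pos.1 hpos
      obtain ⟨hFV, rfl⟩ := mem_filter.1 hF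
      rw [show (V.filter fun F' => c F' = c F).card = 1 by omega, one_mul]
      exact h.sub_le_of_mem hFV
  · refine le_trans (Nat.mul_le_mul_right _ (h.card_fiber_le_card_between htwo))
      (le_trans ?_ (Nat.le_add_right _ _))
    rw [← smul_eq_mul]
    refine (card_nsmul_le_sum _ _ _ fun D hD => ?_).trans
      (sum_le_sum_of_subset (filter_subset _ _))
    obtain ⟨hD, F, hF, rfl, hDF⟩ := mem_filter.1 hD
    obtain ⟨hDc, -, -, -, hTD, -⟩ := mem_between.1 hD
    exact h.sub_le_card_coext hF hTD hDc hDF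

/-- Without conflicts, the members of `V` are paid for by missing extensions of rich sets. -/
lemma card_mul_le_sum_coext (h : IsCore d κ 𝓖 V c) (hn : 2 * (d + 1) ≤ n)
    (hno : ∀ F ∈ V, ∀ F' ∈ V, ¬ Conflict c F F') :
    V.card * (n - d - 2) ≤ ∑ D ∈ rich d 𝓖, (coext 𝓖 D).card + d * (d + 1) * V.card := by
  set B := (V.image c).biUnion (between d V c) with hB
  have hcount : V.card * (n - d - 2) ≤ ∑ T ∈ V.image c,
      (∑ D ∈ between d V c T, (coext 𝓖 D).card +
        ((linking d 𝓖).filter fun D => T ⊆ D).card) := by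
    rw [card_eq_sum_card_image c V, sum_mul]
    exact sum_le_sum fun T _ => h.card_fiber_mul_le T
  have hdisj : ((V.image c : Finset (Finset (Fin n))) : Set (Finset (Fin n))).PairwiseDisjoint
      (between d V c) := by
    intro T _ T' _ hne
    rw [Function.onFun, Finset.disjoint_left]
    intro D hD hD'
    obtain ⟨-, F, hF, rfl, hTD, hDF⟩ := mem_between.1 hD
    obtain ⟨-, F', hF', rfl, hTD', hDF'⟩ := mem_between.1 hD'
    exact hno F hF F' hF' ⟨hne, hTD.trans hDF', hTD'.trans hDF⟩
  rw [sum_add_distrib, ← sum_biUnion hdisj] at hcount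
  have hlink : ∑ T ∈ V.image c, ((linking d 𝓖).filter fun D => T ⊆ D).card ≤
      (linking d 𝓖).card * d := by
    have := sum_card_bipartiteAbove_eq_sum_card_bipartiteBelow
      (s := V.image c) (t := linking d 𝓖) (fun T D => T ⊆ D)
    simp only [bipartiteAbove, bipartiteBelow] at this
    rw [this, ← smul_eq_mul]
    refine sum_le_card_nsmul _ _ _ fun D hD => ?_
    have hDc := (mem_linking.1 hD).1
    rcases Nat.eq_zero_or_pos d with h0 | hpos
    · rw [h0, Nat.le_zero, card_eq_zero, filter_eq_empty_iff]
      intro T hT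
      obtain ⟨F, hF, -⟩ := mem_image.1 hT
      have := h.card_cert F hF
      omega
    · calc ((V.image c).filter fun T => T ⊆ D).card ≤ (powersetCard (d - 1) D).card := by
            refine card_le_card fun T hT => ?_
            obtain ⟨hT, hTD⟩ := mem_filter.1 hT
            obtain ⟨F, hF, rfl⟩ := mem_image.1 hT
            have := h.card_cert F hF
            exact mem_powersetCard.2 ⟨hTD, by omega⟩
        _ = d := by
            rw [card_powersetCard, hDc]
            obtain ⟨e, rfl⟩ := Nat.exists_eq_add_of_le' hpos
            simp
  have hBcard : B.card ≤ V.card * (d + 1) := by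
    refine (card_le_card fun D hD => ?_).trans
      (card_biUnion_le_card_mul V (fun F => powersetCard d F) (d + 1) fun F hF => ?_)
    · obtain ⟨T, -, hD⟩ := mem_biUnion.1 hD
      obtain ⟨hDc, F, hF, -, -, hDF⟩ := mem_between.1 hD
      exact mem_biUnion.2 ⟨F, hF, mem_powersetCard.2 ⟨hDF, hDc⟩⟩
    · rw [card_powersetCard, h.card_eq F (h.subset hF), Nat.choose_succ_self_right]
  have hrest : (linking d 𝓖 \ B).card * d ≤ ∑ D ∈ linking d 𝓖 \ B, (coext 𝓖 D).card := by
    rw [← smul_eq_mul]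
    refine card_nsmul_le_sum _ _ _ fun D hD => ?_
    obtain ⟨hDc, hD2⟩ := mem_linking.1 (mem_sdiff.1 hD).1
    have := card_ext_add_card_coext 𝓖 D
    omega
  have htotal : ∑ D ∈ B, (coext 𝓖 D).card + ∑ D ∈ linking d 𝓖 \ B, (coext 𝓖 D).card ≤
      ∑ D ∈ rich d 𝓖, (coext 𝓖 D).card := by
    rw [← sum_union disjoint_sdiff]
    refine sum_le_sum_of_subset (union_subset ?_ ?_)
    · exact biUnion_subset.2 fun T _ => h.between_subset_rich T
    · intro D hD
      obtain ⟨hDc, hD2⟩ := mem_linking.1 (mem_sdiff.1 hD).1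
      exact UniformVC.mem_rich.2 ⟨hDc, hD2.ge⟩
  have hsplit : (linking d 𝓖).card ≤ B.card + (linking d 𝓖 \ B).card := by
    rw [add_comm]
    exact card_le_card_sdiff_add_card
  have h1 := Nat.mul_le_mul_right d hsplit
  have h2 := Nat.mul_le_mul_right d hBcard
  nlinarith

end IsCore

lemma card_filter_small_cert_le {d κ : ℕ} (hd : 2 ≤ d) (hn : 0 < n) {𝓕 : Finset (Finset (Fin n))}
    {c : Finset (Fin n) → Finset (Fin n)}
    (hfib : ∀ T, (𝓕.filter fun F => c F = T).card ≤ κ) :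
    (𝓕.filter fun F => (c F).card + 1 < d).card ≤ (d - 1) * κ * n ^ (d - 2) := by
  have hsub : (𝓕.filter fun F => (c F).card + 1 < d) ⊆
      ((range (d - 1)).biUnion fun i => powersetCard i univ).biUnion
        fun T => 𝓕.filter fun F => c F = T := by
    intro F hF
    obtain ⟨hF, hc⟩ := mem_filter.1 hF
    refine mem_biUnion.2 ⟨c F, mem_biUnion.2 ⟨(c F).card, mem_range.2 (by omega), ?_⟩,
      mem_filter.2 ⟨hF, rfl⟩⟩
    exact mem_powersetCard.2 ⟨subset_univ _, rfl⟩
  have hT : ((range (d - 1)).biUnion fun i => powersetCard i (univ : Finset (Fin n))).card ≤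
      (d - 1) * n ^ (d - 2) := by
    refine (card_biUnion_le_card_mul _ _ (n ^ (d - 2)) fun i hi => ?_).trans_eq
      (by rw [card_range])
    rw [mem_range] at hi
    rw [card_powersetCard, card_univ, Fintype.card_fin]
    exact (Nat.choose_le_pow n i).trans (Nat.pow_le_pow_right hn (by omega))
  refine (card_le_card hsub).trans ((card_biUnion_le_card_mul _ _ κ fun T _ => hfib T).trans ?_)
  calc _ ≤ (d - 1) * n ^ (d - 2) * κ := Nat.mul_le_mul_right _ hT
    _ = _ := by ring

lemma IsCore.card_le {d κ : ℕ} {𝓖 V : Finset (Finset (Fin n))}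
    {c : Finset (Fin n) → Finset (Fin n)} (h : IsCore d κ 𝓖 V c) :
    V.card ≤ κ * n ^ (d - 1) := by
  have hsub : V ⊆ (powersetCard (d - 1) univ).biUnion fun T => V.filter fun F => c F = T := by
    intro F hF
    have := h.card_cert F hF
    exact mem_biUnion.2 ⟨c F, mem_powersetCard.2 ⟨subset_univ _, by omega⟩,
      mem_filter.2 ⟨hF, rfl⟩⟩
  refine (card_le_card hsub).trans
    ((card_biUnion_le_card_mul _ _ κ fun T _ => h.card_fiber_le T).trans ?_)
  rw [card_powersetCard, card_univ, Fintype.card_fin, mul_comm]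
  exact Nat.mul_le_mul_left _ (Nat.choose_le_pow n (d - 1))

lemma compShadow_subset_bare {d : ℕ} {𝓖 𝓕 : Finset (Finset (Fin n))} (hsub : 𝓖 ⊆ 𝓕) :
    compShadow d 𝓕 ⊆ bare d 𝓖 := by
  intro D hD
  obtain ⟨hD, hDs⟩ := mem_sdiff.1 hD
  refine mem_bare.2 ⟨(mem_powersetCard.1 hD).2, card_eq_zero.2 (eq_empty_of_forall_notMem
    fun x hx => hDs ?_)⟩
  obtain ⟨hx, hG⟩ := mem_ext.1 hx
  exact mem_filter.2 ⟨mem_univ _, _, hsub hG, subset_insert _ _,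
    (card_insert_of_notMem hx).symm⟩

open Classical in
/-- After discarding the members with small certificates, the members with no certificate of
size `d` form a core. -/
lemma isCore_filter {d κ : ℕ} {𝓖 𝓕 : Finset (Finset (Fin n))}
    {c : Finset (Fin n) → Finset (Fin n)} (hcard : ∀ F ∈ 𝓖, F.card = d + 1) (hsub : 𝓖 ⊆ 𝓕)
    (hc : ∀ F ∈ 𝓖, IsCert 𝓕 F (c F)) (hlarge : ∀ F ∈ 𝓖, d ≤ (c F).card + 1)
    (hfib : ∀ T, (𝓕.filter fun F => c F = T).card ≤ κ) :
    IsCore d κ 𝓖 (𝓖.filter fun F => ¬ ∃ D, IsCert 𝓖 F D ∧ D.card = d) c := by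
  have hc' : ∀ F ∈ 𝓖, IsCert 𝓖 F (c F) := fun F hF =>
    ⟨(hc F hF).1, fun G hG => (hc F hF).2 G (hsub hG)⟩
  refine ⟨hcard, filter_subset _ _, fun F hF => hc' F (mem_filter.1 hF).1, fun F hF => ?_,
    fun T => (card_le_card fun F hF => ?_).trans (hfib T), fun F hF D hDF hD => ?_⟩
  · obtain ⟨hF, hno⟩ := mem_filter.1 hF
    have h1 := card_lt_card (hc F hF).1
    rw [hcard F hF] at h1
    have h2 := hlarge F hF
    have h3 : (c F).card ≠ d := fun h => hno ⟨c F, hc' F hF, h⟩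
    omega
  · rw [mem_filter, mem_filter] at hF
    exact mem_filter.2 ⟨hsub hF.1.1, hF.2⟩
  · obtain ⟨hF, hno⟩ := mem_filter.1 hF
    refine mem_rich.2 ⟨hD, ?_⟩
    by_contra! hlt
    have hext : ∀ G ∈ 𝓖, D ⊆ G → ∃ x ∈ ext 𝓖 D, insert x D = G := fun G hG hDG => by
      have hne : D ≠ G := fun h => by
        have := hcard G hG
        rw [← h] at this
        omega
      obtain ⟨x, hxG, hxD⟩ := exists_of_ssubset (hDG.ssubset_of_ne hne)
      have : insert x D = G := eq_of_subset_of_card_le (insert_subset hxG hDG)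
        (by rw [card_insert_of_notMem hxD, hcard G hG, hD])
      exact ⟨x, mem_ext.2 ⟨hxD, this ▸ hG⟩, this⟩
    have hne : D ≠ F := fun h => by
      have := hcard F hF
      rw [← h] at this
      omega
    refine hno ⟨D, ⟨hDF.ssubset_of_ne hne, fun G hG hGF => hne ?_⟩, hD⟩
    obtain ⟨x, hx, rfl⟩ := hext F hF hDF
    obtain ⟨y, hy, rfl⟩ := hext G hG (hGF ▸ inter_subset_left)
    rw [card_le_one.1 (by omega) y hy x hx, inter_self] at hGF
    exact hGF.symm

/-- Combining the linear estimates on the sizes of the parts of the family. -/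
lemma mul_le_of_estimates {n b b' P H K L V U W N C₁ C₂ C₃ κ : ℕ}
    (hcount : n * H + b' + P ≤ n * K) (hK : K ≤ L + (H + V)) (hL : L ≤ C₁ * N)
    (hW : 4 * W ≤ b + C₂ * N) (hV : V ≤ κ * (n * N)) (hUV : U ≤ V) (hVUW : V ≤ U + W)
    (hU : n * U ≤ P + C₃ * U) (hb : n * b ≤ 2 * b') :
    n * b ≤ n * ((4 * C₁ + C₂ + 4 * C₃ * κ) * N) := by
  have h1 := Nat.mul_le_mul_left n hK
  have h2 := Nat.mul_le_mul_left n hL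
  have h3 := Nat.mul_le_mul_left n hW
  have h4 := Nat.mul_le_mul_left n hVUW
  have h5 := Nat.mul_le_mul_left C₃ hV
  have h6 := Nat.mul_le_mul_left C₃ hUV
  linarith

theorem exists_card_compShadow_le (d : ℕ) (hd : 2 ≤ d) :
    ∃ C : ℕ, ∀ n : ℕ, 2 * (d + 1) ≤ n → ∀ 𝓕 : Finset (Finset (Fin n)),
      (∀ F ∈ 𝓕, F.card = d + 1) → VCDimLE 𝓕 d →
      (∀ 𝓖 : Finset (Finset (Fin n)), (∀ F ∈ 𝓖, F.card = d + 1) → VCDimLE 𝓖 d →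
        𝓖.card ≤ 𝓕.card) →
      (compShadow d 𝓕).card ≤ C * n ^ (d - 2) := by
  classical
  set κ := (d + 1) ^ (d + 1) with hκ
  set C₁ := (d - 1) * κ with hC₁
  set C₂ := 4 * (2 * IsCore.nearBound d κ + 4 * 2 ^ d * IsCore.nearBound d κ ^ 2) with hC₂
  set C₃ := d + 2 + d * (d + 1) with hC₃
  refine ⟨4 * C₁ + C₂ + 4 * C₃ * κ, fun n hn 𝓕 hcard hvc hmax => ?_⟩
  obtain ⟨c, hc⟩ := exists_isMaxCertAssignment hcard hvc
  have hfib := card_filter_maxCert_le (by omega : 1 ≤ d + 1) hcard hc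
  set 𝓖 := 𝓕.filter fun F => ¬ (c F).card + 1 < d with h𝓖
  have h𝓖sub : 𝓖 ⊆ 𝓕 := filter_subset _ _
  have h𝓖card : ∀ F ∈ 𝓖, F.card = d + 1 := fun F hF => hcard F (h𝓖sub hF)
  have hcore : IsCore d κ 𝓖 (𝓖.filter fun F => ¬ ∃ D, IsCert 𝓖 F D ∧ D.card = d) c :=
    isCore_filter h𝓖card h𝓖sub (fun F hF => (hc F (h𝓖sub hF)).1)
      (fun F hF => not_lt.1 (mem_filter.1 hF).2) hfib
  set V := 𝓖.filter fun F => ¬ ∃ D, IsCert 𝓖 F D ∧ D.card = d with hV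
  set 𝓗 := 𝓖.filter fun F => ∃ D, IsCert 𝓖 F D ∧ D.card = d with h𝓗
  refine (card_le_card (compShadow_subset_bare h𝓖sub)).trans ?_
  have hsmall := card_filter_small_cert_le hd (by omega : 0 < n) hfib
  have hsplit : (𝓕.filter fun F => (c F).card + 1 < d).card + 𝓖.card = 𝓕.card :=
    card_filter_add_card_filter_not _
  have hsplit' : 𝓗.card + V.card = 𝓖.card := card_filter_add_card_filter_not _
  have hcount := card_private_add_card_bare_le (d := d) (by omega) h𝓖card
    (filter_subset _ _ : 𝓗 ⊆ 𝓖) fun F hF => (mem_filter.1 hF).2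
  have hstar := choose_le_card_of_maximal (d := d) (by omega) hmax
  have hbinom : (n - d) * n.choose d = n * (n - 1).choose d := by
    have := Nat.choose_mul_succ_eq (n - 1) d
    rw [Nat.sub_add_cancel (by omega : 1 ≤ n)] at this
    linarith
  have hconf := hcore.card_conflicting_le
  have hVcard := hcore.card_le
  have hpow : n ^ (d - 1) = n * n ^ (d - 2) := by
    rw [← pow_succ']
    congr 1
    omega
  set U := V \ conflicting V c with hU
  have hUV : U ⊆ V := sdiff_subset
  have hUcard : U.card ≤ V.card := card_le_card hUV
  have hsplitV : V.card ≤ U.card + (conflicting V c).card := card_le_card_sdiff_add_card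
  have hpaid := (hcore.mono hUV).card_mul_le_sum_coext hn fun F hF F' hF' hcon =>
    (mem_sdiff.1 hF).2 (mem_filter.2 ⟨hUV hF, F', hUV hF', hcon⟩)
  rw [hpow] at hVcard
  rw [hbinom] at hcount
  have hpaid' : n * U.card ≤ ∑ D ∈ rich d 𝓖, (coext 𝓖 D).card + C₃ * U.card := by
    obtain ⟨m, rfl⟩ := Nat.exists_eq_add_of_le (by omega : d + 2 ≤ n)
    rw [show d + 2 + m - d - 2 = m by omega] at hpaid
    rw [hC₃]
    nlinarith
  have hhalf : n * (bare d 𝓖).card ≤ 2 * ((n - d) * (bare d 𝓖).card) := by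
    rw [← mul_assoc]
    exact Nat.mul_le_mul_right _ (by omega)
  rw [← hsplit, ← hsplit'] at hstar
  exact Nat.le_of_mul_le_mul_left (mul_le_of_estimates hcount hstar hsmall hconf hVcard hUcard
    hsplitV hpaid' hhalf) (by omega : 0 < n)

end UniformVC

theorem stmt14 (d : ℕ) (hd : 2 ≤ d) :
    ∃ C : ℕ, ∀ n : ℕ, 2 * (d + 1) ≤ n → ∀ 𝓕 : Finset (Finset (Fin n)),
      (∀ F ∈ 𝓕, F.card = d + 1) → VCDimLE 𝓕 d →
      (∀ 𝓖 : Finset (Finset (Fin n)), (∀ F ∈ 𝓖, F.card = d + 1) → VCDimLE 𝓖 d →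
        𝓖.card ≤ 𝓕.card) →
      (compShadow d 𝓕).card ≤ C * n ^ (d - 2) :=
  UniformVC.exists_card_compShadow_le d hd
end
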